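/- arXiv:2104.00156 — 6 statements merged into one kernel-verified Lean document; each statement's English description precedes it below -/
import Mathlib

section
/- For integers 1 ≤ k ≤ n, the map σ ↦ code(σ) is a bijection from the set of ordered set partitions of [n] with exactly k blocks onto the set of sequences (c_1,…,c_n) of nonnegative integers such that (i) c_i < k for all 1 ≤ i ≤ n, and (ii) for every subset S ⊆ [n] with |S| = n−k+1, the componentwise inequality γ(S)* ≤ (c_1,…,c_n) fails to hold. -/
open scoped BigOperators

namespace PackedWords

/-- An ordered set partition of `[n] = {1, …, n}` with `k` blocks: a sequence
`B_1 | ⋯ | B_k` of nonempty pairwise disjoint subsets of `[n]` whose union is `[n]`. -/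
structure OSP (n k : ℕ) where
  blocks : Fin k → Finset ℕ
  subset_range : ∀ j, blocks j ⊆ Finset.Icc 1 n
  blocks_nonempty : ∀ j, (blocks j).Nonempty
  blocks_disjoint : ∀ j₁ j₂ : Fin k, j₁ ≠ j₂ → Disjoint (blocks j₁) (blocks j₂)
  cover : ∀ i ∈ Finset.Icc 1 n, ∃ j, i ∈ blocks j

/-- Common generalization of the coinversion code (`b = 0`) and the boosted
coinversion code (`b = 1`).  Position `p : Fin n` corresponds to the letter
`i = p + 1` of `[n]`.  If `i ∈ B_j` (blocks indexed `0, …, k-1`, so `j` here is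
the paper's `j - 1`), then `c_i = #{ℓ > j : min B_ℓ > i}` if `i = min B_j`, and
`c_i = #{ℓ > j : min B_ℓ > i} + (j - 1) + b` (in the paper's 1-indexing) otherwise. -/
noncomputable def codeAux {n k : ℕ} (b : ℕ) (σ : OSP n k) (p : Fin n) : ℕ :=
  if h : ∃ j, ((p : ℕ) + 1) ∈ σ.blocks j then
    (Finset.univ.filter fun ℓ : Fin k =>
        h.choose < ℓ ∧ ∀ x ∈ σ.blocks ℓ, (p : ℕ) + 1 < x).card
      + (if ∀ x ∈ σ.blocks h.choose, (p : ℕ) + 1 ≤ x then 0 else (h.choose : ℕ) + b)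
  else 0

/-- The coinversion code of an ordered set partition. -/
noncomputable def code {n k : ℕ} (σ : OSP n k) : Fin n → ℕ := codeAux 0 σ

/-- The boosted coinversion code of an ordered set partition. -/
noncomputable def bcode {n k : ℕ} (σ : OSP n k) : Fin n → ℕ := codeAux 1 σ

/-- The skip sequence of a finite set `S = {s_1 < s_2 < ⋯} ⊆ ℕ`:
`γ_i = i - j + 1` if `i = s_j ∈ S`, and `γ_i = 0` otherwise. -/
def skip (S : Finset ℕ) (i : ℕ) : ℕ :=
  if i ∈ S then i - (S.filter (· < i)).card else 0

/-- The reverse skip sequence `γ(S)* = (γ_n, …, γ_1)` of `S ⊆ [n]`, read at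
position `p : Fin n` (so position `p` carries `γ_{n - p}` in 1-indexed terms). -/
def revSkipAt (n : ℕ) (S : Finset ℕ) (p : Fin n) : ℕ := skip S (n - (p : ℕ))

/-- For `T ⊆ [n-1]` with skip sequence `γ = γ(T)`, the length-`n` sequence
`(γ_{n-1}, …, γ_i, d, γ_{i-1}, …, γ_1)` obtained from the reverse skip sequence of `T`
by inserting `d` in position `n - i + 1` (1-indexed), read at position `p : Fin n`. -/
def insSeq (n i d : ℕ) (T : Finset ℕ) (p : Fin n) : ℕ :=
  if (p : ℕ) + 1 ≤ n - i then skip T (n - ((p : ℕ) + 1))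
  else if (p : ℕ) + 1 = n - i + 1 then d
  else skip T (n - ((p : ℕ) + 1) + 1)

/-- `Packedk n k w`: `w` is a packed word of length `n` on the alphabet of positive
integers (whenever `i + 1` appears as a letter, so does `i`) in which each of the
letters `1, 2, …, k` appears. -/
def Packedk (n k : ℕ) (w : Fin n → ℕ) : Prop :=
  (∀ p, 1 ≤ w p) ∧ (∀ i, 1 ≤ i → (∃ p, w p = i + 1) → ∃ p, w p = i) ∧
    (∀ j, 1 ≤ j → j ≤ k → ∃ p, w p = j)

/-- The elementary symmetric polynomial of degree `a` in the variables `X j`, `j ∈ s`. -/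
noncomputable def esymmOn (n : ℕ) (s : Finset (Fin n)) (a : ℕ) : MvPolynomial (Fin n) ℚ :=
  ∑ t ∈ s.powersetCard a, ∏ j ∈ t, MvPolynomial.X j

/-- The complete homogeneous symmetric polynomial of degree `b` evaluated at
`α 1, α 2, …, α d`. -/
noncomputable def hval (b d : ℕ) (α : ℕ → ℚ) : ℚ :=
  ∑ m : Sym (Fin d) b, ((m : Multiset (Fin d)).map fun j => α ((j : ℕ) + 1)).prod

/-- The locus `X_{n,k} ⊆ ℚ^n` of points `(α_{w_1}, …, α_{w_n})` for `w ∈ W_{n,k}`. -/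
def packedPoints (n k : ℕ) (α : ℕ → ℚ) : Set (Fin n → ℚ) :=
  {x | ∃ w : Fin n → ℕ, Packedk n k w ∧ x = fun p => α (w p)}

/-- The ideal `J_n = ⟨x_i^d e_{n-r}^{(i)} : 1 ≤ i ≤ n, 1 ≤ r ≤ d⟩`. -/
noncomputable def Jn (n : ℕ) : Ideal (MvPolynomial (Fin n) ℚ) :=
  Ideal.span {g | ∃ (i : Fin n) (r d : ℕ), 1 ≤ r ∧ r ≤ d ∧
    g = MvPolynomial.X i ^ d * esymmOn n {i}ᶜ (n - r)}

/-- The ideal `J_{n,k} = J_n + ⟨e_n, e_{n-1}, …, e_{n-k+1}⟩`. -/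
noncomputable def Jnk (n k : ℕ) : Ideal (MvPolynomial (Fin n) ℚ) :=
  Jn n ⊔ Ideal.span {g | ∃ j : ℕ, n - k + 1 ≤ j ∧ j ≤ n ∧ g = esymmOn n Finset.univ j}

/-- The Haglund–Rhoades–Shimozono ideal
`I_{n,k} = ⟨x_1^k, …, x_n^k, e_n, e_{n-1}, …, e_{n-k+1}⟩`. -/
noncomputable def Ink (n k : ℕ) : Ideal (MvPolynomial (Fin n) ℚ) :=
  Ideal.span ({g | ∃ i : Fin n, g = MvPolynomial.X i ^ k} ∪
    {g | ∃ j : ℕ, n - k + 1 ≤ j ∧ j ≤ n ∧ g = esymmOn n Finset.univ j})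

/-- `T(X)`: the ideal generated by the top-degree homogeneous components `τ(f)` of
all nonzero polynomials `f` vanishing on `X`. -/
noncomputable def gradedIdeal (n : ℕ) (X : Set (Fin n → ℚ)) : Ideal (MvPolynomial (Fin n) ℚ) :=
  Ideal.span {g | ∃ f : MvPolynomial (Fin n) ℚ, f ≠ 0 ∧
    (∀ x ∈ X, MvPolynomial.eval x f = 0) ∧
    g = MvPolynomial.homogeneousComponent f.totalDegree f}

/-- The degree-`d` homogeneous component of the quotient `ℚ[x_1, …, x_n]/I`,
namely the image of the space of homogeneous polynomials of degree `d`. -/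
noncomputable def quotComp (n : ℕ) (I : Ideal (MvPolynomial (Fin n) ℚ)) (d : ℕ) :
    Submodule ℚ (MvPolynomial (Fin n) ℚ ⧸ I) :=
  Submodule.map (Ideal.Quotient.mkₐ ℚ I).toLinearMap
    (MvPolynomial.homogeneousSubmodule (Fin n) ℚ d)

/-- The degree-`(d - a)` homogeneous component of `ℚ[x_1, …, x_n]/I`, interpreted as
zero when `d - a < 0` (degree shift by `a`). -/
noncomputable def quotCompShift (n : ℕ) (I : Ideal (MvPolynomial (Fin n) ℚ)) (d a : ℕ) :
    Submodule ℚ (MvPolynomial (Fin n) ℚ ⧸ I) :=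
  if a ≤ d then quotComp n I (d - a) else ⊥

lemma packedk_comp {n k : ℕ} {w : Fin n → ℕ} (σ : Equiv.Perm (Fin n)) (h : Packedk n k w) :
    Packedk n k (w ∘ σ) := by
  obtain ⟨h1, h2, h3⟩ := h
  refine ⟨fun p => h1 _, fun i hi hex => ?_, fun j hj hjk => ?_⟩
  · obtain ⟨q, hq⟩ := h2 i hi (by obtain ⟨p, hp⟩ := hex; exact ⟨σ p, hp⟩)
    exact ⟨σ.symm q, by simpa using hq⟩
  · obtain ⟨q, hq⟩ := h3 j hj hjk
    exact ⟨σ.symm q, by simpa using hq⟩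

/-- The left action of a permutation `σ ∈ S_n` on packed words, sending `w` to
`w ∘ σ⁻¹` (the permutation action on positions). -/
noncomputable def wordPerm (n k : ℕ) (σ : Equiv.Perm (Fin n)) :
    {w : Fin n → ℕ // Packedk n k w} ≃ {w : Fin n → ℕ // Packedk n k w} where
  toFun w := ⟨w.1 ∘ σ.symm, packedk_comp σ.symm w.2⟩
  invFun w := ⟨w.1 ∘ σ, packedk_comp σ w.2⟩
  left_inv w := Subtype.ext (funext fun p => by simp)
  right_inv w := Subtype.ext (funext fun p => by simp)

/-- The blocks opened by the letters of the word `w` in positions before `m`. -/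
def opened {n k : ℕ} (w : Fin n → Fin k) (m : ℕ) : Finset (Fin k) :=
  (Finset.univ.filter fun q : Fin n => (q : ℕ) < m).image w

/-- The code letter of an element placed in block `j` when the blocks in `P` are already open. -/
def letterCode {k : ℕ} (P : Finset (Fin k)) (j : Fin k) : ℕ :=
  (Finset.univ.filter fun ℓ : Fin k => j < ℓ ∧ ℓ ∉ P).card + if j ∈ P then (j : ℕ) else 0

/-- The coinversion code of a word, read as a not necessarily surjective block assignment. -/
def wordCode {n k : ℕ} (w : Fin n → Fin k) (p : Fin n) : ℕ :=
  letterCode (opened w p) (w p)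

lemma mem_opened {n k : ℕ} {w : Fin n → Fin k} {m : ℕ} {j : Fin k} :
    j ∈ opened w m ↔ ∃ q : Fin n, (q : ℕ) < m ∧ w q = j := by
  simp [opened]

lemma opened_succ {n k : ℕ} (w : Fin n → Fin k) (p : Fin n) :
    opened w (p + 1) = insert (w p) (opened w p) := by
  ext j
  simp only [mem_opened, Finset.mem_insert]
  constructor
  · rintro ⟨q, hq, rfl⟩
    rcases Nat.lt_succ_iff_lt_or_eq.mp hq with h | h
    · exact Or.inr ⟨q, h, rfl⟩
    · exact Or.inl (congrArg w (Fin.ext h))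
  · rintro (rfl | ⟨q, hq, rfl⟩)
    · exact ⟨p, by omega, rfl⟩
    · exact ⟨q, by omega, rfl⟩

lemma letterCode_lt {k : ℕ} (P : Finset (Fin k)) (j : Fin k) : letterCode P j < k := by
  have h1 : (Finset.univ.filter fun ℓ : Fin k => j < ℓ ∧ ℓ ∉ P).card ≤ (Finset.Ioi j).card :=
    Finset.card_le_card fun ℓ h => by
      simp only [Finset.mem_filter] at h
      exact Finset.mem_Ioi.mpr h.2.1
  rw [Fin.card_Ioi] at h1
  have := j.isLt
  unfold letterCode
  split_ifs <;> omega

lemma mem_iff_le_letterCode {k : ℕ} (P : Finset (Fin k)) (j : Fin k) :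
    j ∈ P ↔ k - P.card ≤ letterCode P j := by
  have hc : Pᶜ.card = k - P.card := by rw [Finset.card_compl, Fintype.card_fin]
  rw [← hc]
  constructor
  · intro hj
    have h : Pᶜ ⊆ (Finset.univ.filter fun ℓ : Fin k => j < ℓ ∧ ℓ ∉ P) ∪ Finset.Iio j := by
      intro ℓ hℓ
      rw [Finset.mem_compl] at hℓ
      have hne : ℓ ≠ j := fun h => hℓ (h ▸ hj)
      rcases lt_or_gt_of_ne hne with h | h <;> simp [h, hℓ]
    have := (Finset.card_le_card h).trans (Finset.card_union_le _ _)
    rw [Fin.card_Iio] at this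
    simpa [letterCode, hj] using this
  · contrapose!
    intro hj
    simp only [letterCode, hj, if_false, add_zero]
    refine Finset.card_lt_card ((Finset.ssubset_iff_of_subset ?_).mpr ⟨j, by simpa using hj, by simp⟩)
    intro ℓ hℓ
    simpa using (Finset.mem_filter.mp hℓ).2.2

lemma letterCode_ne_of_lt {k : ℕ} (P : Finset (Fin k)) {i j : Fin k} (hij : i < j) :
    letterCode P i ≠ letterCode P j := by
  intro h
  have hiff : i ∈ P ↔ j ∈ P := by rw [mem_iff_le_letterCode, mem_iff_le_letterCode, h]
  by_cases hj : j ∈ P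
  · have hsub : (Finset.univ.filter fun ℓ : Fin k => i < ℓ ∧ ℓ ∉ P) ⊆
        (Finset.univ.filter fun ℓ : Fin k => j < ℓ ∧ ℓ ∉ P) ∪ Finset.Ioo i j := by
      intro ℓ hℓ
      simp only [Finset.mem_filter, Finset.mem_univ, true_and] at hℓ
      have hne : ℓ ≠ j := fun h => hℓ.2 (h ▸ hj)
      rcases lt_or_gt_of_ne hne with h | h <;> simp [h, hℓ]
    have hcard := (Finset.card_le_card hsub).trans (Finset.card_union_le _ _)
    rw [Fin.card_Ioo] at hcard
    simp only [letterCode, hj, hiff.mpr hj, if_true] at h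
    have : (i : ℕ) < j := hij
    omega
  · have hi : i ∉ P := fun hi => hj (hiff.mp hi)
    simp only [letterCode, hi, hj, if_false, add_zero] at h
    refine h.not_gt (Finset.card_lt_card
      ((Finset.ssubset_iff_of_subset ?_).mpr ⟨j, by simp [hij, hj], by simp⟩))
    intro ℓ hℓ
    simp only [Finset.mem_filter, Finset.mem_univ, true_and] at hℓ ⊢
    exact ⟨hij.trans hℓ.1, hℓ.2⟩

lemma letterCode_injective {k : ℕ} (P : Finset (Fin k)) : Function.Injective (letterCode P) := by
  intro i j h
  by_contra hne
  rcases lt_or_gt_of_ne hne with hlt | hlt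
  · exact letterCode_ne_of_lt P hlt h
  · exact letterCode_ne_of_lt P hlt h.symm

lemma wordCode_injective {n k : ℕ} :
    Function.Injective (wordCode : (Fin n → Fin k) → Fin n → ℕ) := by
  intro w w' h
  have key : ∀ m : ℕ, ∀ p : Fin n, (p : ℕ) = m → w p = w' p := by
    intro m
    induction m using Nat.strong_induction_on with
    | _ m ih =>
      rintro p rfl
      have hP : opened w p = opened w' p := Finset.image_congr fun q hq =>
        ih q (by simpa using hq) q rfl
      have hp := congrFun h p
      unfold wordCode at hp
      rw [hP] at hp
      exact letterCode_injective _ hp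
  exact funext fun p => key p p rfl

lemma exists_wordCode_eq {n k : ℕ} (c : Fin n → ℕ) (hc : ∀ p, c p < k) :
    ∃ w : Fin n → Fin k, wordCode w = c := by
  let f : (Fin n → Fin k) → (Fin n → Fin k) := fun w p => ⟨wordCode w p, letterCode_lt _ _⟩
  have hf : Function.Injective f := fun w w' h =>
    wordCode_injective (funext fun p => congrArg Fin.val (congrFun h p))
  obtain ⟨w, hw⟩ := Finite.injective_iff_surjective.mp hf fun p => ⟨c p, hc p⟩
  exact ⟨w, funext fun p => congrArg Fin.val (congrFun hw p)⟩

lemma card_opened_le {n k : ℕ} (w : Fin n → Fin k) (T : Finset (Fin n))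
    (hT : ∀ p ∈ T, (opened w p).card = (Finset.univ.filter fun q => q ∉ T ∧ q < p).card →
      w p ∈ opened w p) (m : ℕ) (hm : m ≤ n) :
    (opened w m).card ≤ (Finset.univ.filter fun q : Fin n => q ∉ T ∧ (q : ℕ) < m).card := by
  induction m with
  | zero => simp [opened]
  | succ m ih =>
    have ih := ih (by omega)
    let p : Fin n := ⟨m, hm⟩
    have hop : opened w (m + 1) = insert (w p) (opened w m) := opened_succ w p
    have hmono : (Finset.univ.filter fun q : Fin n => q ∉ T ∧ (q : ℕ) < m) ⊆
        Finset.univ.filter fun q : Fin n => q ∉ T ∧ (q : ℕ) < m + 1 := by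
      intro q hq
      simp only [Finset.mem_filter, Finset.mem_univ, true_and] at hq ⊢
      exact ⟨hq.1, by omega⟩
    have hle := Finset.card_le_card hmono
    have hins := Finset.card_insert_le (w p) (opened w m)
    rw [hop]
    by_cases hp : p ∈ T
    · rcases ih.lt_or_eq with hlt | heq
      · omega
      · rw [Finset.insert_eq_of_mem (hT p hp heq)]
        exact ih.trans hle
    · have hlt := Finset.card_lt_card
        ((Finset.ssubset_iff_of_subset hmono).mpr ⟨p, by simp [p, hp], by simp [p]⟩)
      omega

lemma card_not_mem_lt_add_gt {n : ℕ} (T : Finset (Fin n)) {p : Fin n} (hp : p ∈ T) :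
    (Finset.univ.filter fun q => q ∉ T ∧ q < p).card +
      (Finset.univ.filter fun q => q ∉ T ∧ p < q).card = n - T.card := by
  rw [← Finset.card_union_of_disjoint]
  · have hc : Tᶜ.card = n - T.card := by rw [Finset.card_compl, Fintype.card_fin]
    rw [← hc]
    congr 1
    ext q
    simp only [Finset.mem_union, Finset.mem_filter, Finset.mem_univ, true_and, Finset.mem_compl]
    constructor
    · tauto
    · intro hq
      have hne : q ≠ p := fun h => hq (h ▸ hp)
      rcases lt_or_gt_of_ne hne with h | h <;> tauto
  · rw [Finset.disjoint_filter]
    rintro q - ⟨-, h⟩ ⟨-, h'⟩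
    exact lt_asymm h h'

lemma not_surjective_iff {n k : ℕ} (hk : 1 ≤ k) (hkn : k ≤ n) (w : Fin n → Fin k) :
    ¬ Function.Surjective w ↔ ∃ T : Finset (Fin n), T.card = n - k + 1 ∧
      ∀ p ∈ T, (Finset.univ.filter fun q => q ∉ T ∧ p < q).card + 1 ≤ wordCode w p := by
  constructor
  · intro hw
    let G : Finset (Fin n) := Finset.univ.filter fun p => w p ∉ opened w p
    have hinj : Set.InjOn w G := by
      intro p hp q hq h
      simp only [G, Finset.coe_filter, Finset.mem_univ, true_and, Set.mem_ofPred_eq,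
        mem_opened] at hp hq
      by_contra hne
      rcases lt_or_gt_of_ne hne with hlt | hlt
      · exact hq ⟨p, hlt, h⟩
      · exact hp ⟨q, hlt, h.symm⟩
    have hG : G.card < k := by
      rw [← Finset.card_image_of_injOn hinj]
      have hlt : (G.image w).card < (Finset.univ : Finset (Fin k)).card := by
        refine Finset.card_lt_univ_of_notMem (x := ?_) ?_
        · exact (not_forall.mp hw).choose
        · intro h
          obtain ⟨q, -, hq⟩ := Finset.mem_image.mp h
          exact (not_forall.mp hw).choose_spec ⟨q, hq⟩
      simpa using hlt
    have hGc : n - k + 1 ≤ Gᶜ.card := by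
      rw [Finset.card_compl, Fintype.card_fin]
      omega
    obtain ⟨T, hTG, hT⟩ := Finset.exists_subset_card_eq hGc
    have hmem : ∀ p ∈ T, w p ∈ opened w p := fun p hp => by
      simpa [G] using hTG hp
    refine ⟨T, hT, fun p hp => ?_⟩
    have h1 := card_opened_le w T (fun p hp _ => hmem p hp) p p.isLt.le
    have h2 := (mem_iff_le_letterCode _ _).mp (hmem p hp)
    have h3 := card_not_mem_lt_add_gt T hp
    simp only [Fin.val_fin_lt] at h1
    unfold wordCode
    omega
  · rintro ⟨T, hT, h⟩ hw
    have hle := card_opened_le w T (fun p hp heq => by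
      rw [mem_iff_le_letterCode]
      have h1 := h p hp
      have h2 := card_not_mem_lt_add_gt T hp
      unfold wordCode at h1
      omega) n le_rfl
    have h1 : opened w n = Finset.univ := by
      ext j
      obtain ⟨q, hq⟩ := hw j
      simpa [mem_opened] using ⟨q, hq⟩
    have h2 : (Finset.univ.filter fun q : Fin n => q ∉ T ∧ (q : ℕ) < n) = Tᶜ := by
      ext q
      simp
    rw [h1, h2, Finset.card_compl, Finset.card_univ, Fintype.card_fin, Fintype.card_fin] at hle
    omega

lemma injective_sub_val (n : ℕ) : Function.Injective fun p : Fin n => n - (p : ℕ) := by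
  intro p q h
  have h : n - (p : ℕ) = n - (q : ℕ) := h
  exact Fin.ext (by omega)

lemma revSkipAt_image {n : ℕ} (T : Finset (Fin n)) (p : Fin n) :
    revSkipAt n (T.image fun q : Fin n => n - (q : ℕ)) p =
      if p ∈ T then (Finset.univ.filter fun q => q ∉ T ∧ p < q).card + 1 else 0 := by
  have hmem : n - (p : ℕ) ∈ T.image (fun q : Fin n => n - (q : ℕ)) ↔ p ∈ T :=
    (injective_sub_val n).mem_finset_image
  have hcard : ((T.image fun q : Fin n => n - (q : ℕ)).filter (· < n - (p : ℕ))).card =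
      (T.filter (p < ·)).card := by
    rw [Finset.filter_image, Finset.card_image_of_injective _ (injective_sub_val n)]
    congr 1
    ext q
    simp only [Finset.mem_filter, Fin.lt_def]
    have := q.isLt
    have := p.isLt
    constructor <;> rintro ⟨h, h'⟩ <;> exact ⟨h, by omega⟩
  have hsum : (T.filter (p < ·)).card + (Finset.univ.filter fun q => q ∉ T ∧ p < q).card =
      n - 1 - p := by
    rw [← Fin.card_Ioi, ← Finset.card_union_of_disjoint]
    · congr 1
      ext q
      simp only [Finset.mem_union, Finset.mem_filter, Finset.mem_univ, true_and, Finset.mem_Ioi]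
      tauto
    · rw [Finset.disjoint_left]
      intro q h h'
      exact (Finset.mem_filter.mp h').2.1 (Finset.mem_filter.mp h).1
  unfold revSkipAt skip
  simp only [hmem, hcard]
  have := p.isLt
  split_ifs <;> omega

lemma exists_image_sub_val_eq {n : ℕ} {S : Finset ℕ} (hS : S ⊆ Finset.Icc 1 n) :
    ∃ T : Finset (Fin n), (T.image fun q : Fin n => n - (q : ℕ)) = S := by
  refine ⟨Finset.univ.filter fun q => n - (q : ℕ) ∈ S, ?_⟩
  ext s
  simp only [Finset.mem_image, Finset.mem_filter, Finset.mem_univ, true_and]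
  constructor
  · rintro ⟨q, hq, rfl⟩
    exact hq
  · intro hs
    have hs' := Finset.mem_Icc.mp (hS hs)
    have hsub : n - (n - s) = s := by omega
    exact ⟨⟨n - s, by omega⟩, by simpa only [hsub] using hs, hsub⟩

lemma surjective_iff {n k : ℕ} (hk : 1 ≤ k) (hkn : k ≤ n) (w : Fin n → Fin k) :
    Function.Surjective w ↔ ∀ S : Finset ℕ, S ⊆ Finset.Icc 1 n → S.card = n - k + 1 →
      ¬ ∀ p, revSkipAt n S p ≤ wordCode w p := by
  rw [← not_iff_not, not_surjective_iff hk hkn]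
  push Not
  constructor
  · rintro ⟨T, hT, h⟩
    refine ⟨T.image fun q : Fin n => n - (q : ℕ), ?_, ?_, fun p => ?_⟩
    · intro s hs
      obtain ⟨q, -, rfl⟩ := Finset.mem_image.mp hs
      exact Finset.mem_Icc.mpr ⟨by omega, by omega⟩
    · rw [Finset.card_image_of_injective _ (injective_sub_val n), hT]
    · rw [revSkipAt_image]
      split_ifs with hp
      · exact h p hp
      · exact Nat.zero_le _
  · rintro ⟨S, hS, hcard, h⟩
    obtain ⟨T, rfl⟩ := exists_image_sub_val_eq hS
    rw [Finset.card_image_of_injective _ (injective_sub_val n)] at hcard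
    refine ⟨T, hcard, fun p hp => ?_⟩
    simpa only [revSkipAt_image, hp, if_true] using h p

/-- The word `w` records, in position `p`, the block of `σ` containing the letter `p + 1`. -/
def IsWordOf {n k : ℕ} (w : Fin n → Fin k) (σ : OSP n k) : Prop :=
  ∀ (p : Fin n) (j : Fin k), (p : ℕ) + 1 ∈ σ.blocks j ↔ w p = j

namespace IsWordOf

variable {n k : ℕ} {w : Fin n → Fin k} {σ τ : OSP n k}

lemma mem_blocks_iff (h : IsWordOf w σ) {x : ℕ} {j : Fin k} :
    x ∈ σ.blocks j ↔ ∃ p : Fin n, (p : ℕ) + 1 = x ∧ w p = j := by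
  constructor
  · intro hx
    obtain ⟨h1, h2⟩ := Finset.mem_Icc.mp (σ.subset_range j hx)
    have hsub : x - 1 + 1 = x := by omega
    refine ⟨⟨x - 1, by omega⟩, hsub, (h _ _).mp ?_⟩
    simpa only [hsub] using hx
  · rintro ⟨p, rfl, hp⟩
    exact (h p j).mpr hp

lemma osp_eq (hσ : IsWordOf w σ) (hτ : IsWordOf w τ) : σ = τ := by
  have hb : σ.blocks = τ.blocks := by
    funext j
    ext x
    rw [hσ.mem_blocks_iff, hτ.mem_blocks_iff]
  cases σ
  cases τ
  cases hb
  rfl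

lemma surjective (h : IsWordOf w σ) : Function.Surjective w := by
  intro j
  obtain ⟨x, hx⟩ := σ.blocks_nonempty j
  obtain ⟨p, -, hp⟩ := h.mem_blocks_iff.mp hx
  exact ⟨p, hp⟩

lemma forall_le_iff (h : IsWordOf w σ) (m : ℕ) (j : Fin k) :
    (∀ x ∈ σ.blocks j, m + 1 ≤ x) ↔ j ∉ opened w m := by
  rw [mem_opened]
  constructor
  · rintro hx ⟨q, hq, hj⟩
    have := hx _ ((h q j).mpr hj)
    omega
  · intro hj x hx
    obtain ⟨q, rfl, hq⟩ := h.mem_blocks_iff.mp hx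
    by_contra hlt
    exact hj ⟨q, by omega, hq⟩

lemma code_eq (h : IsWordOf w σ) : code σ = wordCode w := by
  funext p
  have hex : ∃ j, (p : ℕ) + 1 ∈ σ.blocks j := ⟨w p, (h p _).mpr rfl⟩
  have hch : hex.choose = w p := ((h p _).mp hex.choose_spec).symm
  simp only [code, codeAux, dif_pos hex, hch, add_zero, wordCode, letterCode, h.forall_le_iff]
  congr 1
  · congr 1
    refine Finset.filter_congr fun ℓ _ => and_congr_right fun hℓ => ?_
    rw [← h.forall_le_iff]
    refine forall₂_congr fun x hx => ⟨le_of_lt, fun hle => lt_of_le_of_ne hle ?_⟩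
    rintro rfl
    exact hℓ.ne ((h p ℓ).mp hx)
  · by_cases hp : w p ∈ opened w p <;> simp [hp]

end IsWordOf

lemma exists_isWordOf {n k : ℕ} (σ : OSP n k) : ∃ w, IsWordOf w σ := by
  have hcov : ∀ p : Fin n, ∃ j, (p : ℕ) + 1 ∈ σ.blocks j := fun p =>
    σ.cover _ (Finset.mem_Icc.mpr ⟨by omega, by omega⟩)
  choose w hw using hcov
  refine ⟨w, fun p j => ⟨fun hj => ?_, fun hj => hj ▸ hw p⟩⟩
  by_contra hne
  exact Finset.disjoint_left.mp (σ.blocks_disjoint _ _ hne) (hw p) hj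

lemma exists_osp_isWordOf {n k : ℕ} {w : Fin n → Fin k} (hw : Function.Surjective w) :
    ∃ σ : OSP n k, IsWordOf w σ := by
  let B : Fin k → Finset ℕ := fun j =>
    (Finset.univ.filter fun p => w p = j).image fun p : Fin n => (p : ℕ) + 1
  have hB : ∀ (x : ℕ) (j : Fin k), x ∈ B j ↔ ∃ p : Fin n, w p = j ∧ (p : ℕ) + 1 = x := by
    simp [B]
  have hmem : ∀ (p : Fin n) (j : Fin k), (p : ℕ) + 1 ∈ B j ↔ w p = j := by
    intro p j
    rw [hB]
    constructor
    · rintro ⟨q, hq, hqp⟩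
      obtain rfl : q = p := Fin.ext (by omega)
      exact hq
    · exact fun h => ⟨p, h, rfl⟩
  refine ⟨⟨B, fun j x hx => ?_, fun j => ?_, fun i j hij => ?_, fun x hx => ?_⟩, hmem⟩
  · obtain ⟨p, -, rfl⟩ := (hB x j).mp hx
    exact Finset.mem_Icc.mpr ⟨by omega, by omega⟩
  · obtain ⟨p, hp⟩ := hw j
    exact ⟨_, (hmem p j).mpr hp⟩
  · rw [Finset.disjoint_left]
    intro x hi hj
    obtain ⟨p, hp, rfl⟩ := (hB x i).mp hi
    exact hij (hp.symm.trans ((hmem p j).mp hj))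
  · obtain ⟨h1, h2⟩ := Finset.mem_Icc.mp hx
    exact ⟨w ⟨x - 1, by omega⟩, (hB _ _).mpr ⟨⟨x - 1, by omega⟩, rfl, Nat.sub_add_cancel h1⟩⟩

/-- For `1 ≤ k ≤ n`, `σ ↦ code σ` is a bijection from ordered set partitions
of `[n]` with exactly `k` blocks onto the sequences `(c_1, …, c_n)` of nonnegative integers
with `c_i < k` for all `i` and such that for every `S ⊆ [n]` with `|S| = n - k + 1` the
componentwise inequality `γ(S)* ≤ (c_1, …, c_n)` fails. -/
theorem code_bijection (n k : ℕ) (hk : 1 ≤ k) (hkn : k ≤ n) :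
    Function.Injective (fun σ : OSP n k => code σ) ∧
    Set.range (fun σ : OSP n k => code σ) =
      {c : Fin n → ℕ | (∀ p, c p < k) ∧
        ∀ S : Finset ℕ, S ⊆ Finset.Icc 1 n → S.card = n - k + 1 →
          ¬ ∀ p, revSkipAt n S p ≤ c p} := by
  constructor
  · intro σ τ h
    obtain ⟨w, hw⟩ := exists_isWordOf σ
    obtain ⟨w', hw'⟩ := exists_isWordOf τ
    have h : code σ = code τ := h
    rw [hw.code_eq, hw'.code_eq] at h
    obtain rfl := wordCode_injective h
    exact hw.osp_eq hw'
  · ext c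
    constructor
    · rintro ⟨σ, rfl⟩
      obtain ⟨w, hw⟩ := exists_isWordOf σ
      simp only [hw.code_eq]
      exact ⟨fun p => letterCode_lt _ _, (surjective_iff hk hkn w).mp hw.surjective⟩
    · rintro ⟨hc, hS⟩
      obtain ⟨w, rfl⟩ := exists_wordCode_eq c hc
      obtain ⟨σ, hσ⟩ := exists_osp_isWordOf ((surjective_iff hk hkn w).mpr hS)
      exact ⟨σ, hσ.code_eq⟩

end PackedWords
end

section
/- For integers 1 ≤ k ≤ n, the map σ ↦ codē(σ) is a bijection from the set of ordered set partitions of [n] with at least k blocks onto the set of sequences (c_1,…,c_n) of nonnegative integers such that (i) c_i < n for all 1 ≤ i ≤ n, (ii) for every subset S ⊆ [n] with |S| = n−k+1 the componentwise inequality γ(S)* ≤ (c_1,…,c_n) fails to hold, and (iii) for all 1 ≤ i, d ≤ n and every T ⊆ [n−1] with |T| = n−d, writing γ(T)* = (γ_{n−1},…,γ_1), the componentwise inequality (γ_{n−1},…,γ_i, d, γ_{i−1},…,γ_1) ≤ (c_1,…,c_n) fails to hold. -/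
open scoped BigOperators

namespace PackedWords

/-- One step of the filling process: reading `x` with `e` empty blocks left, an empty block
gets filled exactly when `x < e`. -/
def fillStep (x e : ℕ) : ℕ := if x < e then e - 1 else e

/-- The number of empty blocks left after reading `a r, a (r - 1), …, a 1`, starting from
`e` empty blocks. -/
def emptyLeft (a : ℕ → ℕ) : ℕ → ℕ → ℕ
  | 0, e => e
  | r + 1, e => emptyLeft a r (fillStep (a (r + 1)) e)

/-- Reading `a r, a (r - 1), …, a 1` from `e` empty blocks fills all blocks, and never
reads the current number of empty blocks. -/
def FillsExactly (a : ℕ → ℕ) : ℕ → ℕ → Prop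
  | 0, e => e = 0
  | r + 1, e => a (r + 1) ≠ e ∧ FillsExactly a r (fillStep (a (r + 1)) e)

lemma fillStep_mono (x : ℕ) : Monotone (fillStep x) := by
  intro e e' h
  unfold fillStep
  split_ifs <;> omega

lemma fillStep_inj {x e e' : ℕ} (h : x ≠ e) (h' : x ≠ e')
    (heq : fillStep x e = fillStep x e') : e = e' := by
  unfold fillStep at heq
  split_ifs at heq <;> omega

lemma fillStep_succ {x e : ℕ} (h : x ≠ e) : fillStep x (e + 1) = fillStep x e + 1 := by
  unfold fillStep
  split_ifs <;> omega

lemma emptyLeft_mono (a : ℕ → ℕ) (r : ℕ) : Monotone (emptyLeft a r) := by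
  induction r with
  | zero => exact monotone_id
  | succ r ih => exact fun e e' h => ih (fillStep_mono _ h)

lemma emptyLeft_zero (a : ℕ → ℕ) (r : ℕ) : emptyLeft a r 0 = 0 := by
  induction r with
  | zero => rfl
  | succ r ih => simpa [emptyLeft, fillStep] using ih

lemma le_emptyLeft_add (a : ℕ → ℕ) (r e : ℕ) : e ≤ emptyLeft a r e + r := by
  induction r generalizing e with
  | zero => simp [emptyLeft]
  | succ r ih =>
    have h := ih (fillStep (a (r + 1)) e)
    have h' : e ≤ fillStep (a (r + 1)) e + 1 := by
      unfold fillStep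
      split_ifs <;> omega
    simp only [emptyLeft]
    omega

lemma emptyLeft_congr {a b : ℕ → ℕ} {r : ℕ} (h : ∀ s, 1 ≤ s → s ≤ r → a s = b s) (e : ℕ) :
    emptyLeft a r e = emptyLeft b r e := by
  induction r generalizing e with
  | zero => rfl
  | succ r ih =>
    simp only [emptyLeft]
    rw [h (r + 1) (by omega) le_rfl]
    exact ih (fun s hs hsr => h s hs (by omega)) _

lemma FillsExactly.eq {a : ℕ → ℕ} {r e e' : ℕ} (h : FillsExactly a r e)
    (h' : FillsExactly a r e') : e = e' := by
  induction r generalizing e e' with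
  | zero => exact Eq.trans h (Eq.symm h')
  | succ r ih => exact fillStep_inj h.1 h'.1 (ih h.2 h'.2)

lemma FillsExactly.emptyLeft_eq_zero {a : ℕ → ℕ} {r e : ℕ} (h : FillsExactly a r e) :
    emptyLeft a r e = 0 := by
  induction r generalizing e with
  | zero => exact h
  | succ r ih => exact ih h.2

lemma fillsExactly_of_emptyLeft {a : ℕ → ℕ} {r e : ℕ} (h : emptyLeft a r e = 0)
    (h' : emptyLeft a r (e + 1) ≠ 0) : FillsExactly a r e := by
  induction r generalizing e with
  | zero => exact h
  | succ r ih =>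
    simp only [emptyLeft] at h h'
    have hne : a (r + 1) ≠ e := by
      rintro rfl
      simp [fillStep] at h h'
      exact h' h
    rw [fillStep_succ hne] at h'
    exact ⟨hne, ih h h'⟩

/-- A term that is at least the number of empty blocks can be dropped. -/
lemma emptyLeft_drop {a : ℕ → ℕ} {r i e : ℕ} (hi : 1 ≤ i) (hir : i ≤ r + 1) (he : e ≤ a i) :
    emptyLeft (fun s => if s < i then a s else a (s + 1)) r e = emptyLeft a (r + 1) e := by
  have top (r e : ℕ) (he : e ≤ a (r + 1)) :
      emptyLeft (fun s => if s < r + 1 then a s else a (s + 1)) r e = emptyLeft a (r + 1) e := by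
    rw [emptyLeft, show fillStep (a (r + 1)) e = e by simp [fillStep, he]]
    exact emptyLeft_congr (fun s _ hs => if_pos (by omega)) e
  induction r generalizing e with
  | zero =>
    obtain rfl : i = 0 + 1 := by omega
    exact top 0 e he
  | succ r ih =>
    rcases hir.eq_or_lt with rfl | hlt
    · exact top _ _ he
    · rw [emptyLeft, emptyLeft, if_neg (by omega)]
      refine ih (by omega) (le_trans ?_ he)
      unfold fillStep
      split_ifs <;> omega

lemma skip_congr {S S' : Finset ℕ} {r : ℕ} (h : ∀ s ≤ r, s ∈ S ↔ s ∈ S') :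
    skip S r = skip S' r := by
  have hf : S.filter (· < r) = S'.filter (· < r) := by
    ext s
    simp only [Finset.mem_filter]
    constructor <;> rintro ⟨h1, h2⟩
    · exact ⟨(h s h2.le).1 h1, h2⟩
    · exact ⟨(h s h2.le).2 h1, h2⟩
  simp only [skip, h r le_rfl, hf]

lemma skip_insert_top {S : Finset ℕ} {r : ℕ} (hS : S ⊆ Finset.Icc 1 r) :
    skip (insert (r + 1) S) (r + 1) = r + 1 - S.card := by
  have hf : (insert (r + 1) S).filter (· < r + 1) = S := by
    ext s
    simp only [Finset.mem_filter, Finset.mem_insert]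
    constructor
    · rintro ⟨rfl | h, h'⟩
      · omega
      · exact h
    · intro h
      have := Finset.mem_Icc.1 (hS h)
      exact ⟨Or.inr h, by omega⟩
  rw [skip, if_pos (Finset.mem_insert_self _ _), hf]

/-- Some block stays empty if and only if the sequence dominates a skip sequence. -/
lemma emptyLeft_ne_zero_iff (a : ℕ → ℕ) (r e : ℕ) (he : 1 ≤ e) (her : e ≤ r + 1) :
    emptyLeft a r e ≠ 0 ↔ ∃ S : Finset ℕ, S ⊆ Finset.Icc 1 r ∧ S.card = r + 1 - e ∧
      ∀ s, 1 ≤ s → s ≤ r → skip S s ≤ a s := by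
  induction r generalizing e with
  | zero =>
    obtain rfl : e = 1 := by omega
    simp only [emptyLeft, ne_eq, one_ne_zero, not_false_eq_true, true_iff]
    exact ⟨∅, by simp, by simp, fun s hs hs' => by omega⟩
  | succ r ih =>
    simp only [emptyLeft]
    constructor
    · intro h
      rcases her.eq_or_lt with rfl | hlt
      · exact ⟨∅, by simp, by simp, fun s hs hs' => by simp [skip]⟩
      by_cases hx : a (r + 1) < e
      · rw [fillStep, if_pos hx] at h
        have he1 : e - 1 ≠ 0 := fun h0 => h (by rw [h0, emptyLeft_zero])
        obtain ⟨S, hS, hc, hle⟩ := (ih (e - 1) (by omega) (by omega)).1 h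
        refine ⟨S, hS.trans (Finset.Icc_subset_Icc le_rfl (by omega)), by omega,
          fun s hs hs' => ?_⟩
        rcases hs'.eq_or_lt with rfl | hlt'
        · rw [skip, if_neg (fun hm => by have := Finset.mem_Icc.1 (hS hm); omega)]
          exact Nat.zero_le _
        · exact hle s hs (by omega)
      · rw [fillStep, if_neg hx] at h
        obtain ⟨S, hS, hc, hle⟩ := (ih e he (by omega)).1 h
        have hn : r + 1 ∉ S := fun hm => by have := Finset.mem_Icc.1 (hS hm); omega
        refine ⟨insert (r + 1) S, ?_, ?_, fun s hs hs' => ?_⟩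
        · refine Finset.insert_subset (by simp) (hS.trans ?_)
          exact Finset.Icc_subset_Icc le_rfl (by omega)
        · rw [Finset.card_insert_of_notMem hn]
          omega
        · rcases hs'.eq_or_lt with rfl | hlt'
          · rw [skip_insert_top hS]
            omega
          · rw [skip_congr (S' := S)]
            · exact hle s hs (by omega)
            · intro q hq
              simp only [Finset.mem_insert, or_iff_right_iff_imp]
              omega
    · rintro ⟨S, hS, hc, hle⟩
      have hmem : ∀ s ∈ S, s ≠ r + 1 → s ∈ Finset.Icc 1 r := fun s hs hne => by
        have := Finset.mem_Icc.1 (hS hs)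
        exact Finset.mem_Icc.2 ⟨this.1, by omega⟩
      by_cases hr : r + 1 ∈ S
      · have hS' : S.erase (r + 1) ⊆ Finset.Icc 1 r := fun s hs =>
          hmem s (Finset.mem_of_mem_erase hs) (Finset.ne_of_mem_erase hs)
        have hc' := Finset.card_erase_add_one hr
        have htop := skip_insert_top hS'
        rw [Finset.insert_erase hr] at htop
        have hx := hle (r + 1) (by omega) le_rfl
        rw [fillStep, if_neg (by omega)]
        refine (ih e he (by omega)).2 ⟨_, hS', by omega, fun s hs hs' => ?_⟩
        rw [skip_congr (S' := S)]
        · exact hle s hs (by omega)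
        · intro q hq
          simp only [Finset.mem_erase, and_iff_right_iff_imp]
          omega
      · have hS' : S ⊆ Finset.Icc 1 r := fun s hs => hmem s hs (fun h => hr (h ▸ hs))
        have hcr := Finset.card_le_card hS'
        rw [Nat.card_Icc] at hcr
        have h := (ih (e - 1) (by omega) (by omega)).2
          ⟨S, hS', by omega, fun s hs hs' => hle s hs (by omega)⟩
        have hmono : emptyLeft a r (e - 1) ≤ emptyLeft a r (fillStep (a (r + 1)) e) := by
          refine emptyLeft_mono a r ?_
          unfold fillStep
          split_ifs <;> omega
        omega

/-- The boosted coinversion label of block `j` when `U` is the set of empty blocks. -/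
def blockLabel {m : ℕ} (U : Finset (Fin m)) (j : Fin m) : ℕ :=
  (U.filter (j < ·)).card + if j ∈ U then 0 else (j : ℕ) + 1

lemma blockLabel_lt {m : ℕ} {U : Finset (Fin m)} {j : Fin m} (h : j ∈ U) :
    blockLabel U j < U.card := by
  rw [blockLabel, if_pos h, add_zero]
  exact Finset.card_lt_card (Finset.filter_ssubset.2 ⟨j, h, lt_irrefl j⟩)

lemma lt_blockLabel {m : ℕ} {U : Finset (Fin m)} {j : Fin m} (h : j ∉ U) :
    U.card < blockLabel U j := by
  rw [blockLabel, if_neg h]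
  have hle : (U.filter fun x => ¬ j < x).card ≤ j := by
    rw [← Fin.card_Iio j]
    refine Finset.card_le_card fun x hx => ?_
    rw [Finset.mem_filter, not_lt] at hx
    exact Finset.mem_Iio.2 (lt_of_le_of_ne hx.2 fun he => h (he ▸ hx.1))
  have := Finset.card_filter_add_card_filter_not (s := U) (j < ·)
  omega

lemma blockLabel_lt_iff {m : ℕ} {U : Finset (Fin m)} {j : Fin m} :
    blockLabel U j < U.card ↔ j ∈ U :=
  ⟨fun h => by_contra fun hj => (lt_blockLabel hj).not_gt h, blockLabel_lt⟩

lemma blockLabel_ne {m : ℕ} (U : Finset (Fin m)) (j : Fin m) : blockLabel U j ≠ U.card := by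
  by_cases h : j ∈ U
  · exact (blockLabel_lt h).ne
  · exact (lt_blockLabel h).ne'

lemma blockLabel_le {m : ℕ} (U : Finset (Fin m)) (j : Fin m) : blockLabel U j ≤ m := by
  have hle : (U.filter (j < ·)).card ≤ m - 1 - j := by
    rw [← Fin.card_Ioi j]
    exact Finset.card_le_card fun x hx => Finset.mem_Ioi.2 (Finset.mem_filter.1 hx).2
  have := j.isLt
  unfold blockLabel
  split_ifs <;> omega

lemma blockLabel_injective {m : ℕ} (U : Finset (Fin m)) :
    Function.Injective (blockLabel U) := by
  have key : ∀ i j : Fin m, i < j → blockLabel U i ≠ blockLabel U j := by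
    intro i j hij heq
    have hiff : i ∈ U ↔ j ∈ U := by rw [← blockLabel_lt_iff, heq, blockLabel_lt_iff]
    by_cases hj : j ∈ U
    · simp only [blockLabel, hiff.2 hj, hj, if_true, add_zero] at heq
      refine (Finset.card_lt_card ?_).ne heq.symm
      refine ⟨Finset.monotone_filter_right _ fun x _ hx => hij.trans hx, fun hsub => ?_⟩
      have := hsub (Finset.mem_filter.2 ⟨hj, hij⟩)
      exact lt_irrefl j (Finset.mem_filter.1 this).2
    · simp only [blockLabel, mt hiff.1 hj, hj, if_false] at heq
      have hsub : U.filter (i < ·) ⊆ U.filter (j < ·) ∪ Finset.Ioo i j := by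
        intro x hx
        rw [Finset.mem_filter] at hx
        rw [Finset.mem_union, Finset.mem_filter, Finset.mem_Ioo]
        rcases lt_trichotomy x j with h | h | h
        · exact Or.inr ⟨hx.2, h⟩
        · exact absurd (h ▸ hx.1) hj
        · exact Or.inl ⟨hx.1, h⟩
      have hc := (Finset.card_le_card hsub).trans (Finset.card_union_le _ _)
      rw [Fin.card_Ioo] at hc
      have : (i : ℕ) < j := hij
      omega
  intro i j h
  rcases lt_trichotomy i j with hij | hij | hij
  · exact absurd h (key i j hij)
  · exact hij
  · exact absurd h.symm (key j i hij)

lemma exists_blockLabel_eq {m x : ℕ} {U : Finset (Fin m)} (hx : x ≤ m) (hne : x ≠ U.card) :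
    ∃ j, blockLabel U j = x := by
  have himg : Finset.univ.image (blockLabel U) = (Finset.range (m + 1)).erase U.card := by
    refine Finset.eq_of_subset_of_card_le (fun y hy => ?_) ?_
    · obtain ⟨j, -, rfl⟩ := Finset.mem_image.1 hy
      exact Finset.mem_erase.2
        ⟨blockLabel_ne U j, Finset.mem_range.2 (Nat.lt_succ_of_le (blockLabel_le U j))⟩
    · have hU : U.card ≤ m := by simpa using U.card_le_univ
      rw [Finset.card_image_of_injective _ (blockLabel_injective U),
        Finset.card_erase_of_mem (Finset.mem_range.2 (by omega))]
      simp
  have : x ∈ Finset.univ.image (blockLabel U) := by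
    rw [himg]
    exact Finset.mem_erase.2 ⟨hne, Finset.mem_range.2 (by omega)⟩
  obtain ⟨j, -, hj⟩ := Finset.mem_image.1 this
  exact ⟨j, hj⟩

/-- The blocks that receive none of the first `t` letters, letter `q + 1` going to block
`w q`. -/
def unusedBlocks {m : ℕ} (w : ℕ → Fin m) (t : ℕ) : Finset (Fin m) :=
  Finset.univ.filter fun ℓ => ∀ q < t, w q ≠ ℓ

lemma mem_unusedBlocks {m : ℕ} {w : ℕ → Fin m} {t : ℕ} {ℓ : Fin m} :
    ℓ ∈ unusedBlocks w t ↔ ∀ q < t, w q ≠ ℓ := by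
  simp [unusedBlocks]

lemma unusedBlocks_zero {m : ℕ} (w : ℕ → Fin m) : (unusedBlocks w 0).card = m := by
  simp [unusedBlocks]

lemma unusedBlocks_congr {m : ℕ} {w w' : ℕ → Fin m} {t : ℕ} (h : ∀ q < t, w q = w' q) :
    unusedBlocks w t = unusedBlocks w' t := by
  ext ℓ
  simp only [mem_unusedBlocks]
  exact forall₂_congr fun q hq => by rw [h q hq]

lemma card_unusedBlocks_succ {m : ℕ} (w : ℕ → Fin m) (t : ℕ) :
    (unusedBlocks w (t + 1)).card =
      fillStep (blockLabel (unusedBlocks w t) (w t)) (unusedBlocks w t).card := by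
  have h : unusedBlocks w (t + 1) = (unusedBlocks w t).erase (w t) := by
    ext ℓ
    simp only [mem_unusedBlocks, Finset.mem_erase, Nat.lt_succ_iff_lt_or_eq, or_imp,
      forall_and, forall_eq]
    tauto
  rw [h, fillStep]
  split_ifs with hlt
  · rw [Finset.card_erase_of_mem (blockLabel_lt_iff.1 hlt)]
  · rw [Finset.erase_eq_of_notMem (mt blockLabel_lt_iff.2 hlt)]

lemma fillsExactly_of_blockLabel {m n : ℕ} {c : ℕ → ℕ} {w : ℕ → Fin m}
    (hw : ∀ p < n, blockLabel (unusedBlocks w p) (w p) = c p)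
    (hsurj : unusedBlocks w n = ∅) : FillsExactly (fun r => c (n - r)) n m := by
  have key : ∀ r ≤ n, FillsExactly (fun r => c (n - r)) r (unusedBlocks w (n - r)).card := by
    intro r
    induction r with
    | zero =>
      intro _
      simp [FillsExactly, hsurj]
    | succ r ih =>
      intro hr
      have hp := hw (n - (r + 1)) (by omega)
      have hs := card_unusedBlocks_succ w (n - (r + 1))
      rw [hp, show n - (r + 1) + 1 = n - r by omega] at hs
      refine ⟨?_, hs ▸ ih (by omega)⟩
      simp only [← hp]
      exact blockLabel_ne _ _
  simpa [unusedBlocks_zero] using key n le_rfl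

lemma exists_blockLabel_of_fillsExactly {m n : ℕ} {c : ℕ → ℕ} (hm : 1 ≤ m)
    (hc : ∀ p < n, c p ≤ m) (h : FillsExactly (fun r => c (n - r)) n m) :
    ∃ w : ℕ → Fin m, (∀ p < n, blockLabel (unusedBlocks w p) (w p) = c p) ∧
      unusedBlocks w n = ∅ := by
  have key : ∀ t ≤ n, ∃ w : ℕ → Fin m,
      (∀ p < t, blockLabel (unusedBlocks w p) (w p) = c p) ∧
        FillsExactly (fun r => c (n - r)) (n - t) (unusedBlocks w t).card := by
    intro t
    induction t with
    | zero => exact fun _ => ⟨fun _ => ⟨0, hm⟩, by simp, by simpa [unusedBlocks_zero] using h⟩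
    | succ t ih =>
      intro ht
      obtain ⟨w, hw, hf⟩ := ih (by omega)
      rw [show n - t = n - (t + 1) + 1 by omega] at hf
      obtain ⟨hne, hf⟩ := hf
      simp only [show n - (n - (t + 1) + 1) = t by omega] at hne hf
      obtain ⟨j, hj⟩ := exists_blockLabel_eq (hc t (by omega)) hne
      have hagree : ∀ q < t, Function.update w t j q = w q := fun q hq =>
        Function.update_of_ne hq.ne _ _
      have hU : ∀ p ≤ t, unusedBlocks (Function.update w t j) p = unusedBlocks w p :=
        fun p hp => unusedBlocks_congr fun q hq => hagree q (by omega)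
      refine ⟨Function.update w t j, fun p hp => ?_, ?_⟩
      · rw [hU p (by omega)]
        rcases (Nat.lt_succ_iff_lt_or_eq.1 hp) with hlt | rfl
        · rw [hagree p hlt, hw p hlt]
        · rw [Function.update_self, hj]
      · rw [card_unusedBlocks_succ, hU t le_rfl, Function.update_self, hj]
        exact hf
  obtain ⟨w, hw, hf⟩ := key n le_rfl
  rw [Nat.sub_self] at hf
  exact ⟨w, hw, Finset.card_eq_zero.1 hf⟩

lemma eq_of_blockLabel_eq {m n : ℕ} {w w' : ℕ → Fin m}
    (h : ∀ p < n, blockLabel (unusedBlocks w p) (w p) =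
      blockLabel (unusedBlocks w' p) (w' p)) : ∀ p < n, w p = w' p := by
  intro p
  induction p using Nat.strong_induction_on with
  | _ p ih =>
    intro hp
    have h' := h p hp
    rw [unusedBlocks_congr fun q hq => ih q hq (by omega)] at h'
    exact blockLabel_injective _ h'

section OSP

variable {n m : ℕ} {σ : OSP n m} {w : ℕ → Fin m}

lemma OSP.exists_word (σ : OSP n m) (hm : 1 ≤ m) :
    ∃ w : ℕ → Fin m, ∀ q < n, q + 1 ∈ σ.blocks (w q) := by
  have : ∀ q, ∃ j, q < n → q + 1 ∈ σ.blocks j := fun q => by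
    by_cases hq : q < n
    · obtain ⟨j, hj⟩ := σ.cover (q + 1) (Finset.mem_Icc.2 ⟨by omega, by omega⟩)
      exact ⟨j, fun _ => hj⟩
    · exact ⟨⟨0, hm⟩, fun h => absurd h hq⟩
  choose w hw using this
  exact ⟨w, hw⟩

lemma OSP.eq_of_mem (σ : OSP n m) {i : ℕ} {j j' : Fin m} (h : i ∈ σ.blocks j)
    (h' : i ∈ σ.blocks j') : j = j' :=
  by_contra fun hne => Finset.disjoint_left.1 (σ.blocks_disjoint j j' hne) h h'

lemma OSP.mem_blocks_iff (hw : ∀ q < n, q + 1 ∈ σ.blocks (w q)) {i : ℕ} {j : Fin m} :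
    i ∈ σ.blocks j ↔ ∃ q < n, i = q + 1 ∧ w q = j := by
  constructor
  · intro h
    obtain ⟨h1, h2⟩ := Finset.mem_Icc.1 (σ.subset_range j h)
    obtain ⟨q, rfl⟩ := Nat.exists_eq_add_of_le' h1
    exact ⟨q, h2, rfl, σ.eq_of_mem (hw q h2) h⟩
  · rintro ⟨q, hq, rfl, rfl⟩
    exact hw q hq

lemma OSP.unusedBlocks_eq_empty (hw : ∀ q < n, q + 1 ∈ σ.blocks (w q)) :
    unusedBlocks w n = ∅ := by
  refine Finset.eq_empty_of_forall_notMem fun ℓ hℓ => ?_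
  obtain ⟨i, hi⟩ := σ.blocks_nonempty ℓ
  obtain ⟨q, hq, -, hwq⟩ := (OSP.mem_blocks_iff hw).1 hi
  exact mem_unusedBlocks.1 hℓ q hq hwq

lemma bcode_eq_blockLabel (hw : ∀ q < n, q + 1 ∈ σ.blocks (w q)) (p : Fin n) :
    bcode σ p = blockLabel (unusedBlocks w p) (w p) := by
  have hex : ∃ j, ((p : ℕ) + 1) ∈ σ.blocks j := ⟨_, hw p p.isLt⟩
  have hch : hex.choose = w p := σ.eq_of_mem hex.choose_spec (hw p p.isLt)
  unfold bcode codeAux blockLabel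
  rw [dif_pos hex, hch]
  have hmin : (∀ x ∈ σ.blocks (w p), (p : ℕ) + 1 ≤ x) ↔ w p ∈ unusedBlocks w p := by
    rw [mem_unusedBlocks]
    constructor
    · intro h q hq hwq
      have := h (q + 1) ((OSP.mem_blocks_iff hw).2 ⟨q, hq.trans p.isLt, rfl, hwq⟩)
      omega
    · intro h x hx
      obtain ⟨q, hq, rfl, hwq⟩ := (OSP.mem_blocks_iff hw).1 hx
      by_contra hlt
      exact h q (by omega) hwq
  have hset : (Finset.univ.filter fun ℓ : Fin m =>
      w p < ℓ ∧ ∀ x ∈ σ.blocks ℓ, (p : ℕ) + 1 < x) =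
        (unusedBlocks w p).filter (w p < ·) := by
    ext ℓ
    simp only [Finset.mem_filter, Finset.mem_univ, true_and, mem_unusedBlocks]
    rw [and_comm]
    refine and_congr_left fun hlt => ?_
    constructor
    · intro h q hq hwq
      have := h (q + 1) ((OSP.mem_blocks_iff hw).2 ⟨q, hq.trans p.isLt, rfl, hwq⟩)
      omega
    · intro h x hx
      obtain ⟨q, hq, rfl, hwq⟩ := (OSP.mem_blocks_iff hw).1 hx
      by_contra hle
      rcases (show q < p ∨ q = p by omega) with hq' | rfl
      · exact h q hq' hwq
      · exact hlt.ne hwq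
  rw [hset]
  simp only [hmin]

/-- The ordered set partition with letter `q + 1` in block `w q`. -/
def ospOfWord (w : ℕ → Fin m) (hw : unusedBlocks w n = ∅) : OSP n m where
  blocks j := (Finset.Icc 1 n).filter fun i => w (i - 1) = j
  subset_range _ := Finset.filter_subset _ _
  blocks_nonempty j := by
    have : j ∉ unusedBlocks w n := by simp [hw]
    rw [mem_unusedBlocks] at this
    push Not at this
    obtain ⟨q, hq, hwq⟩ := this
    exact ⟨q + 1, by simpa [hwq] using hq⟩
  blocks_disjoint j₁ j₂ hne := by
    refine Finset.disjoint_left.2 fun i h₁ h₂ => hne ?_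
    rw [← (Finset.mem_filter.1 h₁).2, (Finset.mem_filter.1 h₂).2]
  cover i hi := ⟨w (i - 1), Finset.mem_filter.2 ⟨hi, rfl⟩⟩

lemma mem_blocks_ospOfWord (hw : unusedBlocks w n = ∅) :
    ∀ q < n, q + 1 ∈ (ospOfWord w hw).blocks (w q) := fun q hq =>
  Finset.mem_filter.2 ⟨Finset.mem_Icc.2 ⟨by omega, by omega⟩, by simp⟩

end OSP

/-- Extension of a finite sequence by zeros. -/
def extendZero {n : ℕ} (c : Fin n → ℕ) (p : ℕ) : ℕ := if h : p < n then c ⟨p, h⟩ else 0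

lemma extendZero_apply {n : ℕ} (c : Fin n → ℕ) (p : Fin n) : extendZero c p = c p := by
  simp [extendZero]

/-- The sequence `c` indexed from the right: position `r` carries `c_{n - r + 1}`. -/
def fromRight {n : ℕ} (c : Fin n → ℕ) (r : ℕ) : ℕ := extendZero c (n - r)

lemma fromRight_sub {n : ℕ} (c : Fin n → ℕ) (p : Fin n) : fromRight c (n - p) = c p := by
  have := p.isLt
  rw [fromRight, show n - (n - (p : ℕ)) = p by omega, extendZero_apply]

lemma forall_fin_iff_fromRight {n : ℕ} (c : Fin n → ℕ) (P : ℕ → ℕ → Prop) :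
    (∀ p : Fin n, P (n - p) (c p)) ↔ ∀ r, 1 ≤ r → r ≤ n → P r (fromRight c r) := by
  constructor
  · intro h r hr hrn
    have hp := h ⟨n - r, by omega⟩
    rw [← fromRight_sub c] at hp
    simpa [show n - (n - r) = r by omega] using hp
  · intro h p
    have hp := p.isLt
    rw [← fromRight_sub c p]
    exact h _ (by omega) (by omega)

lemma bcode_fillsExactly {n m : ℕ} (hm : 1 ≤ m) (σ : OSP n m) :
    FillsExactly (fromRight (bcode σ)) n m ∧ ∀ p, bcode σ p ≤ m := by
  obtain ⟨w, hw⟩ := σ.exists_word hm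
  refine ⟨fillsExactly_of_blockLabel (c := extendZero (bcode σ)) (w := w) (fun p hp => ?_)
    (OSP.unusedBlocks_eq_empty hw), fun p => ?_⟩
  · rw [extendZero, dif_pos hp, bcode_eq_blockLabel hw]
  · rw [bcode_eq_blockLabel hw]
    exact blockLabel_le _ _

lemma bcode_injective_s1 {n m : ℕ} (hm : 1 ≤ m) :
    Function.Injective (bcode : OSP n m → Fin n → ℕ) := by
  intro σ τ h
  obtain ⟨w, hw⟩ := σ.exists_word hm
  obtain ⟨v, hv⟩ := τ.exists_word hm
  have hwv : ∀ p < n, w p = v p := eq_of_blockLabel_eq fun p hp => by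
    rw [← bcode_eq_blockLabel hw ⟨p, hp⟩, ← bcode_eq_blockLabel hv ⟨p, hp⟩, h]
  have hb : σ.blocks = τ.blocks := by
    ext j i
    rw [OSP.mem_blocks_iff hw, OSP.mem_blocks_iff hv]
    constructor <;> rintro ⟨q, hq, hi, hj⟩
    · exact ⟨q, hq, hi, hwv q hq ▸ hj⟩
    · exact ⟨q, hq, hi, (hwv q hq).trans hj⟩
  cases σ
  cases τ
  cases hb
  rfl

lemma exists_bcode_eq {n m : ℕ} (hm : 1 ≤ m) {c : Fin n → ℕ}
    (h : FillsExactly (fromRight c) n m) (hc : ∀ p, c p ≤ m) :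
    ∃ σ : OSP n m, bcode σ = c := by
  obtain ⟨w, hw, hs⟩ := exists_blockLabel_of_fillsExactly (c := extendZero c) hm
    (fun p hp => by rw [extendZero, dif_pos hp]; exact hc _) h
  refine ⟨ospOfWord w hs, funext fun p => ?_⟩
  rw [bcode_eq_blockLabel (mem_blocks_ospOfWord hs), hw p p.isLt, extendZero_apply]

lemma exists_revSkipAt_le_iff {n k : ℕ} (hk : 1 ≤ k) (hkn : k ≤ n) (c : Fin n → ℕ) :
    (∃ S : Finset ℕ, S ⊆ Finset.Icc 1 n ∧ S.card = n - k + 1 ∧ ∀ p, revSkipAt n S p ≤ c p) ↔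
      emptyLeft (fromRight c) n k ≠ 0 := by
  rw [emptyLeft_ne_zero_iff _ _ _ hk (by omega), show n + 1 - k = n - k + 1 by omega]
  refine exists_congr fun S => and_congr_right fun _ => and_congr_right fun _ => ?_
  exact forall_fin_iff_fromRight c fun r x => skip S r ≤ x

lemma insSeq_le_iff {n i d : ℕ} (hi : 1 ≤ i) (hin : i ≤ n) (T : Finset ℕ) (c : Fin n → ℕ) :
    (∀ p, insSeq n i d T p ≤ c p) ↔ d ≤ fromRight c i ∧ ∀ s, 1 ≤ s → s ≤ n - 1 →
      skip T s ≤ if s < i then fromRight c s else fromRight c (s + 1) := by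
  have hins : ∀ p : Fin n, insSeq n i d T p =
      (fun r => if r < i then skip T r else if r = i then d else skip T (r - 1)) (n - p) := by
    intro p
    have hp := p.isLt
    simp only [insSeq]
    split_ifs <;> first | omega | rfl | (congr 1; omega)
  simp only [hins]
  rw [forall_fin_iff_fromRight c fun r x =>
    (if r < i then skip T r else if r = i then d else skip T (r - 1)) ≤ x]
  constructor
  · intro h
    refine ⟨by simpa using h i hi hin, fun s hs hsn => ?_⟩
    split_ifs with hlt
    · simpa [hlt] using h s hs (by omega)
    · have := h (s + 1) (by omega) (by omega)
      rwa [if_neg (by omega), if_neg (by omega), Nat.add_sub_cancel] at this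
  · rintro ⟨hd, h⟩ r hr hrn
    split_ifs with h1 h2
    · simpa [h1] using h r hr (by omega)
    · exact h2 ▸ hd
    · have := h (r - 1) (by omega) (by omega)
      rwa [if_neg (by omega), Nat.sub_add_cancel hr] at this

lemma exists_insSeq_le_iff {n i d : ℕ} (hi : 1 ≤ i) (hin : i ≤ n) (hd : 1 ≤ d) (hdn : d ≤ n)
    (c : Fin n → ℕ) :
    (∃ T : Finset ℕ, T ⊆ Finset.Icc 1 (n - 1) ∧ T.card = n - d ∧
      ∀ p, insSeq n i d T p ≤ c p) ↔
      d ≤ fromRight c i ∧ emptyLeft (fromRight c) n d ≠ 0 := by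
  have hcard : n - d = n - 1 + 1 - d := by omega
  simp only [insSeq_le_iff hi hin]
  by_cases hdi : d ≤ fromRight c i
  · have hdrop := emptyLeft_drop (r := n - 1) hi (by omega) hdi
    rw [show n - 1 + 1 = n by omega] at hdrop
    rw [← hdrop, emptyLeft_ne_zero_iff _ _ _ hd (by omega), hcard]
    simp only [hdi, true_and]
  · simp [hdi]

/-- The sequences avoiding the skip-sequence patterns are those that fill at least `k`
blocks exactly. -/
lemma avoids_iff_exists_fillsExactly {n k : ℕ} (hk : 1 ≤ k) (c : Fin n → ℕ) :
    ((∀ p, c p < n) ∧ emptyLeft (fromRight c) n k = 0 ∧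
      ∀ i d, 1 ≤ i → i ≤ n → 1 ≤ d → d ≤ n → d ≤ fromRight c i →
        emptyLeft (fromRight c) n d = 0) ↔
      ∃ m, k ≤ m ∧ FillsExactly (fromRight c) n m ∧ ∀ p, c p ≤ m := by
  constructor
  · rintro ⟨hlt, hzero, hins⟩
    have hex : ∃ m, emptyLeft (fromRight c) n m ≠ 0 := by
      refine ⟨n + 1, fun h => ?_⟩
      have := le_emptyLeft_add (fromRight c) n (n + 1)
      omega
    classical
    have hspec := Nat.find_spec hex
    have hkm : k < Nat.find hex := by
      by_contra hle
      have := emptyLeft_mono (fromRight c) n (not_lt.1 hle)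
      omega
    obtain ⟨m, hm⟩ : ∃ m, Nat.find hex = m + 1 := ⟨Nat.find hex - 1, by omega⟩
    rw [hm] at hspec hkm
    have hm0 : emptyLeft (fromRight c) n m = 0 :=
      not_not.1 (Nat.find_min hex (by omega))
    refine ⟨m, by omega, fillsExactly_of_emptyLeft hm0 hspec, fun p => ?_⟩
    by_contra hcp
    have hp := p.isLt
    have hcn := hlt p
    refine hspec (hins (n - p) (m + 1) (by omega) (by omega) (by omega) (by omega) ?_)
    rw [fromRight_sub]
    omega
  · rintro ⟨m, hkm, hf, hc⟩
    have hm0 := hf.emptyLeft_eq_zero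
    have hle : ∀ d ≤ m, emptyLeft (fromRight c) n d = 0 := fun d hd => by
      have := emptyLeft_mono (fromRight c) n hd
      omega
    refine ⟨fun p => ?_, hle k hkm, fun i d hi hin _ _ hdi => ?_⟩
    · by_contra hcp
      have hp := p.isLt
      have hcm := hc p
      have hzero := hle n (by omega)
      have hdrop := emptyLeft_drop (a := fromRight c) (r := n - 1) (i := n - p) (e := n)
        (by omega) (by omega) (by rw [fromRight_sub]; omega)
      rw [show n - 1 + 1 = n by omega, hzero] at hdrop
      have := le_emptyLeft_add
        (fun s => if s < n - p then fromRight c s else fromRight c (s + 1)) (n - 1) n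
      omega
    · refine hle d (hdi.trans ?_)
      have := hc ⟨n - i, by omega⟩
      rwa [← fromRight_sub c, show n - ((⟨n - i, by omega⟩ : Fin n) : ℕ) = i by
        simp only; omega] at this

/-- For `1 ≤ k ≤ n`, `σ ↦ bcode σ` is a bijection from ordered set partitions
of `[n]` with at least `k` blocks onto the sequences `(c_1, …, c_n)` of nonnegative integers
such that (i) `c_i < n` for all `i`, (ii) for every `S ⊆ [n]` with `|S| = n - k + 1` the
componentwise inequality `γ(S)* ≤ (c_1, …, c_n)` fails, and (iii) for all `1 ≤ i, d ≤ n` and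
every `T ⊆ [n-1]` with `|T| = n - d`, the componentwise inequality
`(γ_{n-1}, …, γ_i, d, γ_{i-1}, …, γ_1) ≤ (c_1, …, c_n)` fails, where `γ(T)* = (γ_{n-1}, …, γ_1)`. -/
theorem bcode_bijection (n k : ℕ) (hk : 1 ≤ k) (hkn : k ≤ n) :
    Function.Injective
      (fun σ : {p : (m : ℕ) × OSP n m // k ≤ p.1} => bcode σ.1.2) ∧
    Set.range (fun σ : {p : (m : ℕ) × OSP n m // k ≤ p.1} => bcode σ.1.2) =
      {c : Fin n → ℕ | (∀ p, c p < n) ∧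
        (∀ S : Finset ℕ, S ⊆ Finset.Icc 1 n → S.card = n - k + 1 →
          ¬ ∀ p, revSkipAt n S p ≤ c p) ∧
        (∀ i d : ℕ, 1 ≤ i → i ≤ n → 1 ≤ d → d ≤ n →
          ∀ T : Finset ℕ, T ⊆ Finset.Icc 1 (n - 1) → T.card = n - d →
            ¬ ∀ p, insSeq n i d T p ≤ c p)} := by
  refine ⟨?_, ?_⟩
  · rintro ⟨⟨m, σ⟩, hm⟩ ⟨⟨m', τ⟩, hm'⟩ h
    simp only at h hm hm'
    have hσ := (bcode_fillsExactly (by omega) σ).1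
    rw [h] at hσ
    obtain rfl := hσ.eq (bcode_fillsExactly (by omega) τ).1
    obtain rfl := bcode_injective_s1 (by omega) h
    rfl
  · ext c
    have hRHS : c ∈ {c : Fin n → ℕ | (∀ p, c p < n) ∧
        (∀ S : Finset ℕ, S ⊆ Finset.Icc 1 n → S.card = n - k + 1 →
          ¬ ∀ p, revSkipAt n S p ≤ c p) ∧
        (∀ i d : ℕ, 1 ≤ i → i ≤ n → 1 ≤ d → d ≤ n →
          ∀ T : Finset ℕ, T ⊆ Finset.Icc 1 (n - 1) → T.card = n - d →
            ¬ ∀ p, insSeq n i d T p ≤ c p)} ↔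
        ∃ m, k ≤ m ∧ FillsExactly (fromRight c) n m ∧ ∀ p, c p ≤ m := by
      rw [← avoids_iff_exists_fillsExactly hk, Set.mem_ofPred_eq]
      refine and_congr_right fun _ => and_congr ?_ ?_
      · rw [← not_iff_not, ← ne_eq (emptyLeft _ _ _), ← exists_revSkipAt_le_iff hk hkn]
        push Not
        rfl
      · refine forall_congr' fun i => forall_congr' fun d => forall_congr' fun hi =>
          forall_congr' fun hin => forall_congr' fun hd => forall_congr' fun hdn => ?_
        have h := exists_insSeq_le_iff hi hin hd hdn c
        rw [← not_iff_not, Classical.not_imp, ← ne_eq (emptyLeft _ _ _), ← h]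
        push Not
        rfl
    rw [hRHS]
    constructor
    · rintro ⟨⟨⟨m, σ⟩, hm⟩, rfl⟩
      exact ⟨m, hm, bcode_fillsExactly (hk.trans hm) σ⟩
    · rintro ⟨m, hm, hf, hc⟩
      obtain ⟨σ, rfl⟩ := exists_bcode_eq (hk.trans hm) hf hc
      exact ⟨⟨⟨m, σ⟩, hm⟩, rfl⟩

end PackedWords
end

section
/- The boosted coinversion code map is injective on the set of all ordered set partitions of [n]: if σ and τ are ordered set partitions of [n] (possibly with different numbers of blocks) and codē(σ) = codē(τ), then σ = τ. In particular, both the (unboosted) coinversion code code(σ) and the number of blocks of σ are determined by codē(σ). -/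
open scoped BigOperators

namespace PackedWords

/-- The indices of the blocks of `σ` all of whose elements exceed `m`. -/
def unopened {n k : ℕ} (σ : OSP n k) (m : ℕ) : Finset (Fin k) :=
  Finset.univ.filter fun ℓ => ∀ x ∈ σ.blocks ℓ, m < x

lemma mem_unopened {n k : ℕ} {σ : OSP n k} {m : ℕ} {ℓ : Fin k} :
    ℓ ∈ unopened σ m ↔ ∀ x ∈ σ.blocks ℓ, m < x := by
  simp [unopened]

lemma OSP.index_unique {n k : ℕ} (σ : OSP n k) {i : ℕ} {j₁ j₂ : Fin k}
    (h₁ : i ∈ σ.blocks j₁) (h₂ : i ∈ σ.blocks j₂) : j₁ = j₂ := by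
  by_contra h
  exact Finset.disjoint_left.mp (σ.blocks_disjoint j₁ j₂ h) h₁ h₂

lemma OSP.exists_index {n k : ℕ} (σ : OSP n k) {m : ℕ} (hm : m < n) :
    ∃ j, m + 1 ∈ σ.blocks j :=
  σ.cover (m + 1) (Finset.mem_Icc.mpr ⟨by omega, by omega⟩)

lemma unopened_zero {n k : ℕ} (σ : OSP n k) : unopened σ 0 = Finset.univ :=
  Finset.eq_univ_of_forall fun j => mem_unopened.mpr fun _ hx =>
    (Finset.mem_Icc.mp (σ.subset_range j hx)).1

lemma unopened_self {n k : ℕ} (σ : OSP n k) : unopened σ n = ∅ := by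
  refine Finset.eq_empty_of_forall_notMem fun j hj => ?_
  obtain ⟨x, hx⟩ := σ.blocks_nonempty j
  have h := (Finset.mem_Icc.mp (σ.subset_range j hx)).2
  exact absurd (mem_unopened.mp hj x hx) (by omega)

lemma unopened_succ {n k : ℕ} {σ : OSP n k} {m : ℕ} {j : Fin k} (hj : m + 1 ∈ σ.blocks j) :
    unopened σ (m + 1) = (unopened σ m).erase j := by
  ext ℓ
  rw [Finset.mem_erase, mem_unopened, mem_unopened]
  constructor
  · intro h
    refine ⟨?_, fun x hx => (Nat.lt_succ_self m).trans (h x hx)⟩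
    rintro rfl
    exact lt_irrefl _ (h _ hj)
  · rintro ⟨hne, h⟩ x hx
    refine lt_of_le_of_ne (h x hx) ?_
    rintro rfl
    exact hne (σ.index_unique hx hj)

lemma codeAux_eq {n k : ℕ} (b : ℕ) {σ : OSP n k} {p : Fin n} {j : Fin k}
    (hj : (p : ℕ) + 1 ∈ σ.blocks j) :
    codeAux b σ p = ((unopened σ p).filter (j < ·)).card +
      if j ∈ unopened σ p then 0 else (j : ℕ) + b := by
  have h : ∃ j, (p : ℕ) + 1 ∈ σ.blocks j := ⟨j, hj⟩
  have hc : h.choose = j := σ.index_unique h.choose_spec hj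
  have hfilter : (Finset.univ.filter fun ℓ : Fin k =>
      j < ℓ ∧ ∀ x ∈ σ.blocks ℓ, (p : ℕ) + 1 < x) = (unopened σ p).filter (j < ·) := by
    ext ℓ
    have hs : ℓ ∈ unopened σ (p + 1) ↔ ℓ ≠ j ∧ ℓ ∈ unopened σ p := by
      rw [unopened_succ hj, Finset.mem_erase]
    simp only [Finset.mem_filter, Finset.mem_univ, true_and, ← mem_unopened, hs]
    exact ⟨fun ⟨h₁, _, h₂⟩ => ⟨h₂, h₁⟩, fun ⟨h₂, h₁⟩ => ⟨h₁, h₁.ne', h₂⟩⟩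
  simp only [codeAux, dif_pos h, hc, hfilter, mem_unopened, Nat.succ_le_iff]

/-- The letter `p + 1` is the minimum of its block exactly when its boosted code is at most
the number of blocks with larger minimum. -/
lemma bcode_le_card_unopened_iff {n k : ℕ} {σ : OSP n k} {p : Fin n} {j : Fin k}
    (hj : (p : ℕ) + 1 ∈ σ.blocks j) :
    bcode σ p ≤ (unopened σ (p + 1)).card ↔ j ∈ unopened σ p := by
  rw [bcode, codeAux_eq 1 hj, unopened_succ hj]
  by_cases h : j ∈ unopened σ p
  · simp only [h, if_true, iff_true, add_zero]
    refine Finset.card_le_card fun ℓ hℓ => ?_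
    rw [Finset.mem_filter] at hℓ
    exact Finset.mem_erase.mpr ⟨hℓ.2.ne', hℓ.1⟩
  · simp only [h, if_false, iff_false, not_le, Finset.erase_eq_of_notMem h]
    have hsplit := Finset.card_filter_add_card_filter_not (s := unopened σ p) (j < ·)
    have hle : ((unopened σ p).filter (¬ j < ·)).card ≤ (Finset.Iio j).card := by
      refine Finset.card_le_card fun ℓ hℓ => ?_
      rw [Finset.mem_filter, not_lt] at hℓ
      refine Finset.mem_Iio.mpr (lt_of_le_of_ne hℓ.2 ?_)
      rintro rfl
      exact h hℓ.1
    rw [Fin.card_Iio] at hle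
    omega

lemma card_unopened_eq {n k : ℕ} (σ : OSP n k) (p : Fin n) :
    (unopened σ p).card = (unopened σ (p + 1)).card +
      if bcode σ p ≤ (unopened σ (p + 1)).card then 1 else 0 := by
  obtain ⟨j, hj⟩ := σ.exists_index p.2
  simp only [bcode_le_card_unopened_iff hj]
  rw [unopened_succ hj]
  by_cases h : j ∈ unopened σ p
  · simp only [h, if_true, Finset.card_erase_add_one]
  · simp only [h, if_false, Finset.erase_eq_of_notMem, not_false_eq_true, add_zero]

lemma card_unopened_eq_of_bcode_eq {n k l : ℕ} {σ : OSP n k} {τ : OSP n l}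
    (h : bcode σ = bcode τ) {m : ℕ} (hm : m ≤ n) :
    (unopened σ m).card = (unopened τ m).card := by
  induction hm using Nat.decreasingInduction with
  | self => rw [unopened_self, unopened_self, Finset.card_empty, Finset.card_empty]
  | of_succ m hm ih =>
    have hσ := card_unopened_eq σ ⟨m, hm⟩
    have hτ := card_unopened_eq τ ⟨m, hm⟩
    simp only [h, ih] at hσ hτ
    rw [hσ, hτ]

lemma numBlocks_eq_of_bcode_eq {n k l : ℕ} {σ : OSP n k} {τ : OSP n l}
    (h : bcode σ = bcode τ) : k = l := by
  simpa [unopened_zero] using card_unopened_eq_of_bcode_eq h (Nat.zero_le n)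

lemma card_filter_lt_strictAntiOn {k : ℕ} (s : Finset (Fin k)) :
    StrictAntiOn (fun j => (s.filter (j < ·)).card) (s : Set (Fin k)) := by
  intro j _ j' hj' hlt
  refine Finset.card_lt_card (Finset.ssubset_iff_of_subset ?_ |>.mpr ⟨j', ?_, ?_⟩)
  · exact Finset.monotone_filter_right s fun _ _ h => hlt.trans h
  · exact Finset.mem_filter.mpr ⟨hj', hlt⟩
  · simp

lemma card_filter_lt_add_strictMonoOn {k : ℕ} (s : Finset (Fin k)) :
    StrictMonoOn (fun j => (s.filter (j < ·)).card + (j : ℕ)) (s : Set (Fin k))ᶜ := by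
  intro j _ j' hj' hlt
  have hsub : s.filter (j < ·) ⊆ s.filter (j' < ·) ∪ Finset.Ioo j j' := by
    intro ℓ hℓ
    rw [Finset.mem_filter] at hℓ
    rw [Finset.mem_union, Finset.mem_filter, Finset.mem_Ioo]
    rcases lt_trichotomy ℓ j' with h | rfl | h
    · exact Or.inr ⟨hℓ.2, h⟩
    · exact absurd hℓ.1 hj'
    · exact Or.inl ⟨hℓ.1, h⟩
  have hcard := (Finset.card_le_card hsub).trans (Finset.card_union_le _ _)
  rw [Fin.card_Ioo] at hcard
  have hlt' : (j : ℕ) < j' := hlt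
  change (s.filter (j < ·)).card + (j : ℕ) < (s.filter (j' < ·)).card + (j' : ℕ)
  omega

lemma index_eq_of_unopened_eq {n k : ℕ} {σ τ : OSP n k} (h : bcode σ = bcode τ) {p : Fin n}
    (hp : unopened σ p = unopened τ p) {j j' : Fin k}
    (hj : (p : ℕ) + 1 ∈ σ.blocks j) (hj' : (p : ℕ) + 1 ∈ τ.blocks j') : j = j' := by
  have hiff : j ∈ unopened τ p ↔ j' ∈ unopened τ p := by
    rw [← bcode_le_card_unopened_iff hj', ← hp, ← bcode_le_card_unopened_iff hj, h,
      card_unopened_eq_of_bcode_eq h p.2]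
  have hcode := congrFun h p
  rw [bcode, bcode, codeAux_eq 1 hj, codeAux_eq 1 hj', hp] at hcode
  by_cases hmem : j ∈ unopened τ p
  · have hmem' := hiff.mp hmem
    simp only [hmem, hmem', if_true, add_zero] at hcode
    exact (card_filter_lt_strictAntiOn (unopened τ p)).injOn hmem hmem' hcode
  · have hmem' := mt hiff.mpr hmem
    simp only [hmem, hmem', if_false] at hcode
    refine (card_filter_lt_add_strictMonoOn (unopened τ p)).injOn hmem hmem' ?_
    omega

lemma unopened_eq_of_bcode_eq {n k : ℕ} {σ τ : OSP n k} (h : bcode σ = bcode τ) {m : ℕ}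
    (hm : m ≤ n) : unopened σ m = unopened τ m := by
  induction m with
  | zero => rw [unopened_zero, unopened_zero]
  | succ m ih =>
    have hmn : m < n := hm
    have ih := ih hmn.le
    obtain ⟨j, hj⟩ := σ.exists_index hmn
    obtain ⟨j', hj'⟩ := τ.exists_index hmn
    rw [unopened_succ hj, unopened_succ hj', ih,
      index_eq_of_unopened_eq (p := ⟨m, hmn⟩) h ih hj hj']

lemma blocks_subset_of_bcode_eq {n k : ℕ} {σ τ : OSP n k} (h : bcode σ = bcode τ)
    (j : Fin k) : σ.blocks j ⊆ τ.blocks j := by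
  intro i hi
  obtain ⟨h₁, h₂⟩ := Finset.mem_Icc.mp (σ.subset_range j hi)
  obtain ⟨m, rfl⟩ := Nat.exists_eq_add_of_le' h₁
  obtain ⟨j', hj'⟩ := τ.exists_index h₂
  rwa [index_eq_of_unopened_eq (p := ⟨m, h₂⟩) h (unopened_eq_of_bcode_eq h (by omega)) hi hj']

lemma eq_of_bcode_eq {n k : ℕ} {σ τ : OSP n k} (h : bcode σ = bcode τ) : σ = τ := by
  have hblocks : σ.blocks = τ.blocks := funext fun j =>
    (blocks_subset_of_bcode_eq h j).antisymm (blocks_subset_of_bcode_eq h.symm j)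
  cases σ
  cases τ
  congr

/-- The boosted coinversion code map is injective on the set of all ordered
set partitions of `[n]` (with any numbers of blocks); in particular the number of blocks
and the unboosted coinversion code are determined by the boosted coinversion code. -/
theorem bcode_injective (n : ℕ) :
    Function.Injective (fun p : (m : ℕ) × OSP n m => bcode p.2) ∧
    ∀ p q : (m : ℕ) × OSP n m, bcode p.2 = bcode q.2 →
      p.1 = q.1 ∧ code p.2 = code q.2 := by
  have hinj : Function.Injective (fun p : (m : ℕ) × OSP n m => bcode p.2) := by
    rintro ⟨k, σ⟩ ⟨l, τ⟩ h
    change bcode σ = bcode τ at h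
    obtain rfl := numBlocks_eq_of_bcode_eq h
    rw [eq_of_bcode_eq h]
  refine ⟨hinj, fun p q h => ?_⟩
  obtain rfl := hinj h
  exact ⟨rfl, rfl⟩

end PackedWords
end

section
/- Let 1 ≤ k ≤ n and let σ be an ordered set partition of [n] with at least k blocks, with boosted coinversion code codē(σ) = (c_1,…,c_n). Then for every subset S ⊆ [n] with |S| = n−k+1, the componentwise inequality γ(S)* ≤ (c_1,…,c_n) fails to hold. -/
open scoped BigOperators

namespace PackedWords

/-- The number of blocks of `σ` all of whose letters exceed `i`. -/
def minsAbove {n m : ℕ} (σ : OSP n m) (i : ℕ) : ℕ :=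
  (Finset.univ.filter fun ℓ : Fin m => ∀ x ∈ σ.blocks ℓ, i < x).card

lemma OSP.eq_of_mem_s4 {n m : ℕ} (σ : OSP n m) {x : ℕ} {j₁ j₂ : Fin m}
    (h₁ : x ∈ σ.blocks j₁) (h₂ : x ∈ σ.blocks j₂) : j₁ = j₂ := by
  by_contra h
  exact Finset.disjoint_left.1 (σ.blocks_disjoint _ _ h) h₁ h₂

lemma minsAbove_zero {n m : ℕ} (σ : OSP n m) : minsAbove σ 0 = m := by
  have h : ∀ ℓ : Fin m, ∀ x ∈ σ.blocks ℓ, 0 < x := fun ℓ x hx =>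
    (Finset.mem_Icc.1 (σ.subset_range ℓ hx)).1
  rw [minsAbove, Finset.filter_true_of_mem fun ℓ _ => h ℓ, Finset.card_univ, Fintype.card_fin]

lemma minsAbove_self {n m : ℕ} (σ : OSP n m) : minsAbove σ n = 0 := by
  rw [minsAbove, Finset.card_eq_zero, Finset.filter_eq_empty_iff]
  intro ℓ _ h
  obtain ⟨x, hx⟩ := σ.blocks_nonempty ℓ
  have := (Finset.mem_Icc.1 (σ.subset_range ℓ hx)).2
  have := h x hx
  omega

lemma minsAbove_le_succ_add_one {n m : ℕ} (σ : OSP n m) {i : ℕ} (hi : i < n) :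
    minsAbove σ i ≤ minsAbove σ (i + 1) + 1 := by
  obtain ⟨j, hj⟩ := σ.cover (i + 1) (Finset.mem_Icc.2 ⟨by omega, by omega⟩)
  refine (Finset.card_le_card ?_).trans (Finset.card_insert_le j _)
  intro ℓ hℓ
  simp only [Finset.mem_filter, Finset.mem_univ, true_and, Finset.mem_insert] at hℓ ⊢
  by_cases hx : i + 1 ∈ σ.blocks ℓ
  · exact Or.inl (σ.eq_of_mem_s4 hx hj)
  · exact Or.inr fun x hxℓ => lt_of_le_of_ne (hℓ x hxℓ) fun h => hx (h ▸ hxℓ)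

lemma bcode_le_or_minsAbove_le {n m : ℕ} (σ : OSP n m) (p : Fin n) :
    bcode σ p ≤ minsAbove σ (p + 1) ∨ minsAbove σ p ≤ minsAbove σ (p + 1) := by
  have hex : ∃ j, (p : ℕ) + 1 ∈ σ.blocks j :=
    σ.cover _ (Finset.mem_Icc.2 ⟨by omega, p.isLt⟩)
  by_cases hmin : ∀ x ∈ σ.blocks hex.choose, (p : ℕ) + 1 ≤ x
  · left
    rw [bcode, codeAux, dif_pos hex, if_pos hmin, add_zero]
    exact Finset.card_le_card (Finset.monotone_filter_right _ fun ℓ _ h => h.2)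
  · right
    refine Finset.card_le_card (Finset.monotone_filter_right _ fun ℓ _ h x hx => ?_)
    refine lt_of_le_of_ne (h x hx) fun hpx => hmin ?_
    rw [σ.eq_of_mem_s4 hex.choose_spec (hpx ▸ hx)]
    exact h

lemma card_filter_lt_succ (S : Finset ℕ) (a : ℕ) :
    (S.filter (· < a + 1)).card = (S.filter (· < a)).card + if a ∈ S then 1 else 0 := by
  split_ifs with h
  · rw [← Finset.card_insert_of_notMem (a := a) (by simp)]
    congr 1
    ext x
    simp only [Finset.mem_filter, Finset.mem_insert]
    grind
  · rw [add_zero]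
    congr 1
    ext x
    simp only [Finset.mem_filter]
    grind

/-- If the reverse skip sequence of `S` lies below the boosted code of `σ`, then for every `i`
more block minima than non-members of `{s : n + 1 - s ∈ S}` exceed `i`. -/
lemma lt_minsAbove_add_card {n m : ℕ} (σ : OSP n m) (S : Finset ℕ) (hS : S ⊆ Finset.Icc 1 n)
    (hcard : n < m + S.card) (hle : ∀ p, revSkipAt n S p ≤ bcode σ p) :
    ∀ i ≤ n, n - i < minsAbove σ i + (S.filter (· < n - i + 1)).card := by
  intro i
  induction i with
  | zero =>
    intro _
    rw [minsAbove_zero, Finset.filter_true_of_mem]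
    · simpa using hcard
    · intro x hx
      have := (Finset.mem_Icc.1 (hS hx)).2
      omega
  | succ i ih =>
    intro hi
    have hlt := ih (by omega)
    have hdrop := minsAbove_le_succ_add_one σ (i := i) (by omega)
    have hsucc := card_filter_lt_succ S (n - i)
    have hstep := bcode_le_or_minsAbove_le σ ⟨i, hi⟩
    have hskip := hle ⟨i, hi⟩
    rw [show n - (i + 1) + 1 = n - i by omega]
    simp only [revSkipAt, skip] at hskip hstep
    split_ifs at hskip hsucc <;> omega

/-- if `1 ≤ k ≤ n` and `σ` is an ordered set partition of `[n]` with at least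
`k` blocks, then for every `S ⊆ [n]` with `|S| = n - k + 1` the componentwise inequality
`γ(S)* ≤ bcode σ` fails. -/
theorem bcode_no_skip (n k : ℕ) (hk : 1 ≤ k) (hkn : k ≤ n) (m : ℕ) (hm : k ≤ m)
    (σ : OSP n m) (S : Finset ℕ) (hS : S ⊆ Finset.Icc 1 n) (hcard : S.card = n - k + 1) :
    ¬ ∀ p, revSkipAt n S p ≤ bcode σ p := by
  intro hle
  have h := lt_minsAbove_add_card σ S hS (by omega) hle n le_rfl
  have hempty : S.filter (· < n - n + 1) = ∅ :=
    Finset.filter_eq_empty_iff.2 fun x hx => by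
      have := (Finset.mem_Icc.1 (hS hx)).1
      omega
  rw [minsAbove_self, hempty] at h
  simp at h

end PackedWords
end

section
/- Let σ be any ordered set partition of [n] with boosted coinversion code codē(σ) = (c_1,…,c_n). Then for all 1 ≤ i, d ≤ n and every subset T ⊆ [n−1] with |T| = n−d, writing γ(T)* = (γ_{n−1},…,γ_1), the componentwise inequality (γ_{n−1},…,γ_i, d, γ_{i−1},…,γ_1) ≤ (c_1,…,c_n) fails to hold. -/
open scoped BigOperators

namespace PackedWords

/-- The minimum of the `j`-th block. -/
def OSP.blockMin {n k : ℕ} (σ : OSP n k) (j : Fin k) : ℕ :=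
  (σ.blocks j).min' (σ.blocks_nonempty j)

namespace OSP

variable {n k : ℕ} (σ : OSP n k)

lemma blockMin_mem (j : Fin k) : σ.blockMin j ∈ σ.blocks j :=
  Finset.min'_mem _ _

lemma block_unique {x : ℕ} {j₁ j₂ : Fin k} (h₁ : x ∈ σ.blocks j₁) (h₂ : x ∈ σ.blocks j₂) :
    j₁ = j₂ := by
  by_contra h
  exact Finset.disjoint_left.mp (σ.blocks_disjoint j₁ j₂ h) h₁ h₂

lemma blockMin_injective : Function.Injective σ.blockMin := fun j₁ j₂ h =>
  σ.block_unique (σ.blockMin_mem j₁) (h ▸ σ.blockMin_mem j₂)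

lemma card_le_of_blockMin_mem_image (F : Finset (Fin k)) (V : Finset ℕ) (f : ℕ → ℕ)
    (h : ∀ ℓ ∈ F, σ.blockMin ℓ ∈ V.image f) : F.card ≤ V.card := by
  calc F.card = (F.image σ.blockMin).card :=
        (Finset.card_image_of_injective _ σ.blockMin_injective).symm
    _ ≤ (V.image f).card := Finset.card_le_card (Finset.image_subset_iff.mpr h)
    _ ≤ V.card := Finset.card_image_le

end OSP

lemma bcode_eq {n k : ℕ} (σ : OSP n k) (p : Fin n) (j : Fin k)
    (hj : (p : ℕ) + 1 ∈ σ.blocks j) :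
    bcode σ p = (Finset.univ.filter fun ℓ : Fin k => j < ℓ ∧ (p : ℕ) + 1 < σ.blockMin ℓ).card
      + (if (p : ℕ) + 1 = σ.blockMin j then 0 else (j : ℕ) + 1) := by
  have h : ∃ j, (p : ℕ) + 1 ∈ σ.blocks j := ⟨j, hj⟩
  have hc : h.choose = j := σ.block_unique h.choose_spec hj
  have hmin : (∀ x ∈ σ.blocks j, (p : ℕ) + 1 ≤ x) ↔ (p : ℕ) + 1 = σ.blockMin j :=
    ⟨fun hx => le_antisymm (hx _ (σ.blockMin_mem j)) (Finset.min'_le _ _ hj),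
      fun hx x hxj => hx ▸ Finset.min'_le _ _ hxj⟩
  have hlt (ℓ : Fin k) : (∀ x ∈ σ.blocks ℓ, (p : ℕ) + 1 < x) ↔ (p : ℕ) + 1 < σ.blockMin ℓ :=
    (Finset.lt_min'_iff _ _).symm
  simp only [bcode, codeAux, dif_pos h, hc, hmin, hlt]

lemma bcode_le {n k : ℕ} (σ : OSP n k) (p : Fin n) : bcode σ p ≤ k := by
  obtain ⟨j, hj⟩ := σ.cover ((p : ℕ) + 1) (Finset.mem_Icc.mpr ⟨by omega, p.isLt⟩)
  have hcard : (Finset.univ.filter fun ℓ : Fin k =>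
      j < ℓ ∧ (p : ℕ) + 1 < σ.blockMin ℓ).card ≤ k - 1 - j := by
    rw [← Fin.card_Ioi]
    exact Finset.card_le_card fun ℓ hℓ => by simp_all
  rw [bcode_eq σ p j hj]
  split_ifs <;> omega

lemma card_sdiff_filter_lt_lt_skip {n t : ℕ} {T : Finset ℕ} (hT : T ⊆ Finset.Icc 1 (n - 1))
    (ht : t ∈ T) : ((Finset.Icc 1 (n - 1) \ T).filter (· < t)).card < skip T t := by
  have htn := Finset.mem_Icc.mp (hT ht)
  have hdisj : Disjoint ((Finset.Icc 1 (n - 1) \ T).filter (· < t)) (T.filter (· < t)) :=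
    Finset.disjoint_filter_filter Finset.sdiff_disjoint
  have hunion : ((Finset.Icc 1 (n - 1) \ T).filter (· < t)) ∪ (T.filter (· < t))
      = Finset.Icc 1 (t - 1) := by
    rw [← Finset.filter_union, Finset.sdiff_union_of_subset hT]
    ext x
    simp only [Finset.mem_filter, Finset.mem_Icc]
    omega
  have hcard := Finset.card_union_of_disjoint hdisj
  rw [hunion, Nat.card_Icc] at hcard
  rw [skip, if_pos ht]
  omega

/-- for any ordered set partition `σ` of `[n]`, all `1 ≤ i, d ≤ n` and every
`T ⊆ [n-1]` with `|T| = n - d`, writing `γ(T)* = (γ_{n-1}, …, γ_1)`, the componentwise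
inequality `(γ_{n-1}, …, γ_i, d, γ_{i-1}, …, γ_1) ≤ bcode σ` fails. -/
theorem bcode_no_augmented_skip (n m : ℕ) (σ : OSP n m) (i d : ℕ)
    (hi : 1 ≤ i) (hin : i ≤ n) (hd : 1 ≤ d) (hdn : d ≤ n)
    (T : Finset ℕ) (hT : T ⊆ Finset.Icc 1 (n - 1)) (hcard : T.card = n - d) :
    ¬ ∀ p, insSeq n i d T p ≤ bcode σ p := by
  intro hle
  set U := Finset.Icc 1 (n - 1) \ T with hU
  -- the letter whose entry in the augmented sequence is `γ_t`
  set e : ℕ → ℕ := fun t => if i ≤ t then n - t else n - t + 1 with he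
  have hUcard : U.card = d - 1 := by
    rw [hU, Finset.card_sdiff_of_subset hT, Nat.card_Icc, hcard]
    omega
  have hins : d ≤ bcode σ ⟨n - i, by omega⟩ := by
    simpa [insSeq] using hle ⟨n - i, by omega⟩
  by_cases hall : ∀ j, σ.blockMin j ∈ U.image e
  · have hm := σ.card_le_of_blockMin_mem_image Finset.univ U e fun j _ => hall j
    rw [Finset.card_univ, Fintype.card_fin] at hm
    have := bcode_le σ ⟨n - i, by omega⟩
    omega
  · push Not at hall
    obtain ⟨j, hj, hmax⟩ : ∃ j, σ.blockMin j ∉ U.image e ∧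
        ∀ ℓ, j < ℓ → σ.blockMin ℓ ∈ U.image e := by
      obtain ⟨j₀, hj₀⟩ := hall
      obtain ⟨j, hj⟩ := (Set.toFinite {j | σ.blockMin j ∉ U.image e}).exists_maximal ⟨j₀, hj₀⟩
      exact ⟨j, hj.prop, fun ℓ hℓ => by_contra fun h => hj.not_prop_of_gt hℓ h⟩
    have hs := Finset.mem_Icc.mp (σ.subset_range j (σ.blockMin_mem j))
    obtain ⟨p, hp⟩ : ∃ p : Fin n, (p : ℕ) + 1 = σ.blockMin j :=
      ⟨⟨σ.blockMin j - 1, by omega⟩, by simp only; omega⟩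
    have hc := bcode_eq σ p j (hp ▸ σ.blockMin_mem j)
    rw [if_pos hp, add_zero] at hc
    by_cases hpa : (p : ℕ) = n - i
    · have hcU := σ.card_le_of_blockMin_mem_image
        (Finset.univ.filter fun ℓ : Fin m => j < ℓ ∧ (p : ℕ) + 1 < σ.blockMin ℓ) U e
        fun ℓ hℓ => hmax ℓ (Finset.mem_filter.mp hℓ).2.1
      have : p = ⟨n - i, by omega⟩ := Fin.ext hpa
      rw [← this] at hins
      omega
    · obtain ⟨t, ht1, htn, hte, htins⟩ : ∃ t, 1 ≤ t ∧ t ≤ n - 1 ∧ e t = (p : ℕ) + 1 ∧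
          insSeq n i d T p = skip T t := by
        by_cases h : (p : ℕ) + 1 ≤ n - i
        · refine ⟨n - ((p : ℕ) + 1), by omega, by omega, ?_, by rw [insSeq, if_pos h]⟩
          simp only [he]
          split_ifs <;> omega
        · refine ⟨n - ((p : ℕ) + 1) + 1, by omega, by omega, ?_, by
            rw [insSeq, if_neg h, if_neg (by omega)]⟩
          simp only [he]
          split_ifs <;> omega
      have htT : t ∈ T := by
        by_contra h
        exact hj (Finset.mem_image.mpr
          ⟨t, Finset.mem_sdiff.mpr ⟨Finset.mem_Icc.mpr ⟨ht1, htn⟩, h⟩, hte.trans hp⟩)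
      have hcU := σ.card_le_of_blockMin_mem_image
        (Finset.univ.filter fun ℓ : Fin m => j < ℓ ∧ (p : ℕ) + 1 < σ.blockMin ℓ)
        (U.filter (· < t)) e fun ℓ hℓ => by
          obtain ⟨-, hjℓ, hpℓ⟩ := Finset.mem_filter.mp hℓ
          obtain ⟨u, hu, hue⟩ := Finset.mem_image.mp (hmax ℓ hjℓ)
          refine Finset.mem_image.mpr ⟨u, Finset.mem_filter.mpr ⟨hu, ?_⟩, hue⟩
          rw [← hue, ← hte] at hpℓ
          simp only [he] at hpℓ
          split_ifs at hpℓ <;> omega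
      have hskip := card_sdiff_filter_lt_lt_skip hT htT
      rw [← hU] at hskip
      have hlep := hle p
      omega

end PackedWords
end

section
/- Fix n distinct rational numbers α_1,…,α_n and 1 ≤ k ≤ n. For all 1 ≤ i ≤ n and 1 ≤ r ≤ d ≤ n, the polynomial (x_i − α_1)(x_i − α_2)⋯(x_i − α_d) · Σ_{a+b = n−r} (−1)^a e_a^{(i)} · h_b(α_1,…,α_d) in ℚ[x_1,…,x_n] vanishes at every point of X_{n,k}. -/
open scoped BigOperators

namespace PackedWords

open PowerSeries in
lemma coeff_prod_one_sub_C_mul_X {R σ : Type*} [CommRing R] (s : Finset σ) (f : σ → R) (a : ℕ) :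
    coeff a (∏ j ∈ s, (1 - C (f j) * X)) =
      (-1) ^ a * ∑ t ∈ s.powersetCard a, ∏ j ∈ t, f j := by
  classical
  have h (t : Finset σ) : coeff a (∏ j ∈ t, (-(C (f j) * X))) =
      if t.card = a then (-1) ^ a * ∏ j ∈ t, f j else 0 := by
    have : ∏ j ∈ t, (-(C (f j) * X)) = C ((-1) ^ t.card * ∏ j ∈ t, f j) * X ^ t.card := by
      rw [Finset.prod_neg, Finset.prod_mul_distrib, Finset.prod_const]
      simp [mul_assoc]
    rw [this, coeff_C_mul, coeff_X_pow]
    split_ifs with h₁ h₂ h₂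
    · simp [h₂]
    · exact absurd h₁.symm h₂
    · exact absurd h₂.symm h₁
    · simp
  simp_rw [sub_eq_add_neg]
  rw [Finset.prod_one_add, map_sum, Finset.sum_congr rfl fun t _ => h t, ← Finset.sum_filter,
    ← Finset.powersetCard_eq_filter, Finset.mul_sum]

open PowerSeries in
lemma coeff_prod_mk_pow {R σ : Type*} [CommRing R] [Fintype σ] [DecidableEq σ]
    (f : σ → R) (b : ℕ) :
    coeff b (∏ j, PowerSeries.mk fun m => f j ^ m) =
      ∑ m : Sym σ b, ((m : Multiset σ).map f).prod := by
  rw [coeff_prod]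
  simp only [coeff_mk]
  symm
  refine Finset.sum_bij' (fun m _ => (Sym.equivNatSum σ b m : σ →₀ ℕ))
    (fun l hl => (Sym.equivNatSum σ b).symm ⟨l, ?_⟩) ?_ ?_ ?_ ?_ ?_
  · simpa [Finsupp.sum_fintype] using hl
  · intro m _
    have h := (Sym.equivNatSum σ b m).2
    rw [Finsupp.sum_fintype _ _ (by simp)] at h
    exact Finset.mem_finsuppAntidiag.2 ⟨h, Finset.subset_univ _⟩
  · simp
  · simp
  · simp
  · intro m _
    rw [Finset.prod_multiset_map_count]
    simp only [Sym.coe_equivNatSum_apply_apply]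
    refine Finset.prod_subset (Finset.subset_univ _) fun j _ hj => ?_
    rw [Multiset.mem_toFinset] at hj
    simp [Multiset.count_eq_zero_of_notMem hj]

open PowerSeries in
lemma mk_pow_mul_one_sub_C_mul_X {R : Type*} [CommRing R] (c : R) :
    (PowerSeries.mk fun m => c ^ m) * (1 - C c * X) = 1 := by
  ext m
  rw [mul_sub, mul_one, mul_left_comm, map_sub, coeff_C_mul]
  cases m with
  | zero => simp
  | succ m => simp [coeff_succ_mul_X, coeff_one, pow_succ']

open PowerSeries in
lemma coeff_prod_one_sub_C_mul_X_eq_zero {R σ : Type*} [CommRing R] (s : Finset σ) (f : σ → R)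
    {a : ℕ} (h : s.card < a) : coeff a (∏ j ∈ s, (1 - C (f j) * X)) = 0 := by
  rw [coeff_prod_one_sub_C_mul_X, Finset.powersetCard_eq_empty.2 h]
  simp

open PowerSeries in
/-- The supersymmetric sum `∑ (-1)^a e_a h_b` vanishes in high degree when the variables of the
`h_b` occur, at distinct positions, among the variables of the `e_a`. -/
lemma sum_esymm_mul_hsymm_eq_zero {R σ τ : Type*} [CommRing R] [Fintype τ] [DecidableEq τ]
    [DecidableEq σ] (s : Finset σ) (f : σ → R) (p : τ → σ) (hp : Function.Injective p)
    (hps : ∀ t, p t ∈ s) {N : ℕ} (hN : s.card < N + Fintype.card τ) :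
    ∑ a ∈ Finset.range (N + 1), (-1) ^ a * (∑ t ∈ s.powersetCard a, ∏ j ∈ t, f j) *
      ∑ m : Sym τ (N - a), ((m : Multiset τ).map fun j => f (p j)).prod = 0 := by
  have hsub : Finset.univ.image p ⊆ s := by
    simpa [Finset.subset_iff] using hps
  have hcard : (Finset.univ.image p).card = Fintype.card τ := by
    rw [Finset.card_image_of_injective _ hp, Finset.card_univ]
  have hprod : (∏ j ∈ s, (1 - C (f j) * X)) * ∏ t, (PowerSeries.mk fun m => f (p t) ^ m) =
      ∏ j ∈ s \ Finset.univ.image p, (1 - C (f j) * X) := by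
    rw [← Finset.prod_sdiff hsub, Finset.prod_image hp.injOn, mul_assoc,
      ← Finset.prod_mul_distrib]
    have (t : τ) : (1 - C (f (p t)) * X) * (PowerSeries.mk fun m => f (p t) ^ m) = 1 := by
      rw [mul_comm, mk_pow_mul_one_sub_C_mul_X]
    simp [this]
  have h : coeff N (∏ j ∈ s \ Finset.univ.image p, (1 - C (f j) * X)) = 0 := by
    apply coeff_prod_one_sub_C_mul_X_eq_zero
    rw [Finset.card_sdiff_of_subset hsub]
    have := Finset.card_le_card hsub
    omega
  rw [← hprod, coeff_mul, Finset.Nat.sum_antidiagonal_eq_sum_range_succ_mk] at h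
  simpa only [coeff_prod_one_sub_C_mul_X, coeff_prod_mk_pow] using h

lemma Packedk.exists_eq_of_le {n k : ℕ} {w : Fin n → ℕ} (h : Packedk n k w) {m j : ℕ}
    (hm : ∃ p, w p = m) (hj : 1 ≤ j) (hjm : j ≤ m) : ∃ p, w p = j := by
  induction hjm using Nat.decreasingInduction with
  | self => exact hm
  | of_succ l _ ih => exact h.2.1 l hj (ih (by omega))

/-- for distinct rationals `α_1, …, α_n`, `1 ≤ k ≤ n`, `1 ≤ i ≤ n` and
`1 ≤ r ≤ d ≤ n`, the polynomial
`(x_i - α_1)⋯(x_i - α_d) · Σ_{a+b=n-r} (-1)^a e_a^{(i)} h_b(α_1, …, α_d)`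
vanishes at every point of `X_{n,k}`. -/
theorem generator_vanishes (n k : ℕ) (hk : 1 ≤ k) (hkn : k ≤ n) (α : ℕ → ℚ)
    (hα : Set.InjOn α (Set.Icc 1 n)) (i : Fin n) (r d : ℕ)
    (hr : 1 ≤ r) (hrd : r ≤ d) (hdn : d ≤ n)
    (x : Fin n → ℚ) (hx : x ∈ packedPoints n k α) :
    MvPolynomial.eval x
      ((∏ t ∈ Finset.range d, (MvPolynomial.X i - MvPolynomial.C (α (t + 1)))) *
        ∑ a ∈ Finset.range (n - r + 1),
          (-1) ^ a * esymmOn n ({i}ᶜ : Finset (Fin n)) a *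
            MvPolynomial.C (hval (n - r - a) d α)) = 0 := by
  obtain ⟨w, hw, rfl⟩ := hx
  rw [map_mul, mul_eq_zero]
  rcases le_or_gt (w i) d with hwi | hwi
  · left
    have h1 := hw.1 i
    rw [map_prod]
    refine Finset.prod_eq_zero (i := w i - 1) (by rw [Finset.mem_range]; omega) ?_
    simp [Nat.sub_add_cancel h1]
  · right
    have hex (t : Fin d) : ∃ p, w p = (t : ℕ) + 1 :=
      hw.exists_eq_of_le ⟨i, rfl⟩ (by omega) (by omega)
    choose p hp using hex
    have hinj : Function.Injective p := fun s t hst => by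
      have := hp s
      rw [hst, hp t] at this
      exact Fin.ext (by omega)
    have hmem (t : Fin d) : p t ∈ ({i}ᶜ : Finset (Fin n)) := by
      rw [Finset.mem_compl, Finset.mem_singleton]
      intro h
      have := hp t
      rw [h] at this
      omega
    have h := sum_esymm_mul_hsymm_eq_zero (N := n - r) ({i}ᶜ : Finset (Fin n))
      (fun q => α (w q)) p hinj hmem
      (by rw [Finset.card_compl, Finset.card_singleton, Fintype.card_fin, Fintype.card_fin]
          have := i.isLt
          omega)
    simp only [hp] at h
    simpa [esymmOn, hval] using h

end PackedWords
end
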